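/- arXiv:2307.02876 — 4 statements merged into one kernel-verified Lean document; each statement's English description precedes it below -/
import Mathlib

section
/- For every real ξ > 0 and every integer k ≥ 3, there exists a k-uniform hypergraph F whose codegree Turán density satisfies 0 < γ(F) < ξ. -/
open Finset

open scoped Classical

/-- The degree of a set of vertices `s` in the edge set `E`: the number of edges containing `s`. -/
noncomputable def hdeg {α : Type*} [DecidableEq α] (E : Finset (Finset α)) (s : Finset α) : ℕ :=
  (E.filter fun e => s ⊆ e).card

/-- The hypergraph with edge set `F` (on vertex type `α`) has a copy inside the hypergraph with
edge set `E` (on vertex type `β`). -/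
def HasCopy {α β : Type*} [DecidableEq β] (F : Finset (Finset α)) (E : Finset (Finset β)) :
    Prop :=
  ∃ f : α → β, Function.Injective f ∧ ∀ e ∈ F, e.image f ∈ E

/-- The codegree Turán number `exco k n F`: the largest `d` such that some `F`-free `k`-uniform
hypergraph on `n` vertices has minimum codegree at least `d`. -/
noncomputable def exco {α : Type*} (k n : ℕ) (F : Finset (Finset α)) : ℕ :=
  sSup {d : ℕ | ∃ E : Finset (Finset (Fin n)), (∀ e ∈ E, e.card = k) ∧ ¬ HasCopy F E ∧
    ∀ s : Finset (Fin n), s.card = k - 1 → d ≤ hdeg E s}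

/-- The codegree Turán density `γ(F)`. -/
noncomputable def codegTuranDensity {α : Type*} (k : ℕ) (F : Finset (Finset α)) : ℝ :=
  Filter.limsup (fun n : ℕ => (exco k n F : ℝ) / n) Filter.atTop

/-- The `k`-uniform zycle of length `ℓ`: vertices are pairs `(i, j)` with `i ∈ Fin ℓ`,
`j ∈ Fin (k-1)`; for each `i, j` there is an edge `{(i, 1), …, (i, k-1), (i+1, j)}`
(first coordinate taken modulo `ℓ`). -/
def zycle (k ℓ : ℕ) : Finset (Finset (Fin ℓ × Fin (k - 1))) :=
  Finset.univ.image fun p : Fin ℓ × Fin (k - 1) =>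
    insert (⟨(p.1.val + 1) % ℓ, Nat.mod_lt _ p.1.pos⟩, p.2)
      (Finset.univ.image fun j : Fin (k - 1) => (p.1, j))

/-- `e ▷ f` : every extension of `e` by a vertex of `f` is an edge. -/
def Tri {α : Type*} [DecidableEq α] (E : Finset (Finset α)) (e f : Finset α) : Prop :=
  ∀ v ∈ f, insert v e ∈ E

theorem pow_mul_card_le_sum_pow {ι : Type*} [Fintype ι] (f : ι → ℝ) (hf : ∀ i, 0 ≤ f i) {a : ℝ}
    (ha : 0 ≤ a) (h : a * Fintype.card ι ≤ ∑ i, f i) {p : ℕ} (hp : p ≠ 0) :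
    a ^ p * Fintype.card ι ≤ ∑ i, f i ^ p := by
  obtain ⟨p, rfl⟩ := Nat.exists_eq_succ_of_ne_zero hp
  rcases isEmpty_or_nonempty ι with hι | hι
  · simp
  have hc : (0 : ℝ) < Fintype.card ι := by exact_mod_cast Fintype.card_pos
  have := pow_sum_div_card_le_sum_pow (s := (Finset.univ : Finset ι)) (f := f) (fun i _ => hf i) p
  refine le_trans ?_ this
  rw [le_div_iff₀ (by simpa using pow_pos hc p)]
  calc a ^ (p + 1) * Fintype.card ι * (Finset.univ : Finset ι).card ^ p
      = (a * Fintype.card ι) ^ (p + 1) := by rw [Finset.card_univ]; ring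
    _ ≤ _ := pow_le_pow_left₀ (by positivity) h _

theorem card_filter_fin_succ {r : ℕ} {Y : Type*} [Fintype Y] (p : (Fin (r + 1) → Y) → Prop)
    [DecidablePred p] :
    (Finset.univ.filter p).card =
      ∑ y, (Finset.univ.filter fun x : Fin r → Y => p (Fin.cons y x)).card := by
  simp only [Finset.card_filter]
  rw [← (Fin.consEquiv fun _ : Fin (r + 1) => Y).sum_comp, Fintype.sum_prod_type]
  rfl

theorem card_blowup_ge {X : Type*} [Fintype X] {t : ℕ} (ht : t ≠ 0) (r : ℕ)
    (S : Finset (Fin r → X)) {c : ℝ} (hc : 0 ≤ c)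
    (hS : c * (Fintype.card X : ℝ) ^ r ≤ S.card) :
    c ^ t ^ r * (Fintype.card X : ℝ) ^ (r * t) ≤
      (Finset.univ.filter fun T : Fin r → Fin t → X =>
        ∀ φ : Fin r → Fin t, (fun i => T i (φ i)) ∈ S).card := by
  induction r generalizing c with
  | zero =>
    have hT : ∀ (T : Fin 0 → Fin t → X) (φ : Fin 0 → Fin t),
      (fun i => T i (φ i)) = default := fun _ _ => Subsingleton.elim _ _
    rcases S.eq_empty_or_nonempty with rfl | ⟨x, hx⟩
    · simpa using hS
    · have hx' : default ∈ S := by rwa [Subsingleton.elim default x]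
      have : (S.card : ℝ) ≤ 1 := by
        exact_mod_cast (Finset.card_le_univ S).trans (by simp)
      simp only [hT, hx']
      simp at hS ⊢
      linarith
  | succ r ih =>
    rcases isEmpty_or_nonempty X with hX | hX
    · simp [ht]
    set N : ℝ := (Fintype.card X : ℝ) with hN
    have hN0 : 0 < N := by rw [hN]; exact_mod_cast Fintype.card_pos
    let B : (Fin t → X) → Finset (Fin r → X) := fun τ =>
      Finset.univ.filter fun x => ∀ s, (Fin.cons (τ s) x : Fin (r + 1) → X) ∈ S
    let deg : (Fin r → X) → ℕ := fun x =>
      (Finset.univ.filter fun y => (Fin.cons y x : Fin (r + 1) → X) ∈ S).card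
    have hdeg : ∑ x, deg x = S.card := by
      have hS' : S.card = (Finset.univ.filter fun f => f ∈ S).card := by
        congr 1; ext; simp
      rw [hS', card_filter_fin_succ]
      simp only [deg, Finset.card_filter]
      exact Finset.sum_comm
    have hB : ∑ τ, (B τ).card = ∑ x, deg x ^ t := by
      have h1 : ∀ x, deg x ^ t =
          (Finset.univ.filter fun τ : Fin t → X =>
            ∀ s, (Fin.cons (τ s) x : Fin (r + 1) → X) ∈ S).card := by
        intro x
        have : (Finset.univ.filter fun τ : Fin t → X =>
            ∀ s, (Fin.cons (τ s) x : Fin (r + 1) → X) ∈ S) =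
            Fintype.piFinset fun _ : Fin t =>
              Finset.univ.filter fun y => (Fin.cons y x : Fin (r + 1) → X) ∈ S := by
          ext τ; simp
        rw [this, Fintype.card_piFinset_const]
      simp only [h1, B, Finset.card_filter]
      exact Finset.sum_comm
    have hpm1 := pow_mul_card_le_sum_pow (fun x => (deg x : ℝ)) (fun _ => by positivity)
      (a := c * N) (by positivity) (by
        have : ∑ x, (deg x : ℝ) = S.card := by exact_mod_cast hdeg
        rw [this]
        refine le_trans (le_of_eq ?_) hS
        simp [← hN]; ring) ht
    have hpm2 := pow_mul_card_le_sum_pow (fun τ => ((B τ).card : ℝ) / N ^ r)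
      (fun _ => by positivity) (a := c ^ t) (by positivity) (by
        rw [← Finset.sum_div, le_div_iff₀ (by positivity)]
        have : ∑ τ, ((B τ).card : ℝ) = ∑ x, (deg x : ℝ) ^ t := by exact_mod_cast hB
        rw [this]
        refine le_trans (le_of_eq ?_) hpm1
        rw [Fintype.card_fun, Fintype.card_fun]
        simp only [Fintype.card_fin, Nat.cast_pow, ← hN]
        ring) (pow_ne_zero r ht)
    rw [card_filter_fin_succ]
    push_cast
    have hle : ∀ τ : Fin t → X, (((B τ).card : ℝ) / N ^ r) ^ t ^ r * N ^ (r * t) ≤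
        ((Finset.univ.filter fun T : Fin r → Fin t → X => ∀ φ : Fin (r + 1) → Fin t,
          (fun i => (Fin.cons τ T : Fin (r + 1) → Fin t → X) i (φ i)) ∈ S).card : ℝ) := by
      intro τ
      refine (ih (B τ) (c := ((B τ).card : ℝ) / N ^ r) (by positivity) ?_).trans ?_
      · rw [div_mul_cancel₀ _ (by positivity)]
      · norm_cast
        refine Finset.card_le_card fun T hT => ?_
        simp only [Finset.mem_filter, Finset.mem_univ, true_and, B] at hT ⊢
        intro φ
        convert hT (fun i => φ i.succ) (φ 0) using 1
        ext i
        refine Fin.cases ?_ (fun i => ?_) i <;> simp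
    refine le_trans ?_ (Finset.sum_le_sum fun τ _ => hle τ)
    rw [← Finset.sum_mul]
    refine le_trans (le_of_eq ?_) (mul_le_mul_of_nonneg_right hpm2 (by positivity))
    simp [← hN]
    ring

theorem exists_injective_of_card_lt {I V : Type*} [Fintype I] [Fintype V]
    (𝒯 : Finset (I → V)) {c : ℝ} (hc : 0 < c)
    (h𝒯 : c * (Fintype.card V : ℝ) ^ Fintype.card I ≤ 𝒯.card)
    (hV : (Fintype.card I : ℝ) ^ 2 < c * Fintype.card V) : ∃ f ∈ 𝒯, Function.Injective f := by
  by_contra! hcon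
  have hV0 : (0 : ℝ) < Fintype.card V := by
    by_contra h
    have : (0 : ℝ) ≤ (Fintype.card I : ℝ) ^ 2 := by positivity
    nlinarith
  have hsub : 𝒯 ⊆ (Finset.univ.filter fun p : I × I => p.1 ≠ p.2).biUnion fun p =>
      Finset.univ.filter fun f : I → V => f p.1 = f p.2 := by
    intro f hf
    have := hcon f hf
    simp only [Function.Injective, not_forall] at this
    obtain ⟨a, b, hab, hne⟩ := this
    simp only [Finset.mem_biUnion, Finset.mem_filter, Finset.mem_univ, true_and]
    exact ⟨(a, b), hne, hab⟩
  have hone : ∀ p ∈ (Finset.univ.filter fun p : I × I => p.1 ≠ p.2),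
      (Finset.univ.filter fun f : I → V => f p.1 = f p.2).card ≤
        Fintype.card V ^ (Fintype.card I - 1) := by
    rintro ⟨a, b⟩ hp
    simp only [Finset.mem_filter, Finset.mem_univ, true_and] at hp
    have : Fintype.card ({i : I // i ≠ a} → V) = Fintype.card V ^ (Fintype.card I - 1) := by
      rw [Fintype.card_fun]
      simp
    rw [← this, ← Finset.card_univ]
    refine Finset.card_le_card_of_injOn (fun f i => f i.1) (fun _ _ => Finset.mem_univ _) ?_
    intro f hf g hg hfg
    simp only [Finset.coe_filter, Finset.mem_univ, true_and, Set.mem_ofPred_eq] at hf hg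
    have h' : ∀ i, i ≠ a → f i = g i := fun i hi => congrFun hfg ⟨i, hi⟩
    funext i
    by_cases hi : i = a
    · rw [hi, hf, hg, h' b (Ne.symm hp)]
    · exact h' i hi
  have h1 := (Finset.card_le_card hsub).trans (Finset.card_biUnion_le_card_mul _ _ _ hone)
  have h2 : (Finset.univ.filter fun p : I × I => p.1 ≠ p.2).card ≤ Fintype.card I ^ 2 := by
    refine (Finset.card_le_univ _).trans ?_
    simp [sq]
  have h3 : (𝒯.card : ℝ) ≤
      (Fintype.card I : ℝ) ^ 2 * (Fintype.card V : ℝ) ^ (Fintype.card I - 1) := by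
    exact_mod_cast h1.trans (Nat.mul_le_mul_right _ h2)
  rcases Nat.eq_zero_or_pos (Fintype.card I) with h0 | h0
  · rw [h0] at h3 h𝒯
    simp at h3 h𝒯
    rw [h3] at h𝒯
    simp at h𝒯
    linarith
  · obtain ⟨q, hq⟩ : ∃ q, Fintype.card I = q + 1 := ⟨_, (Nat.succ_pred_eq_of_pos h0).symm⟩
    have h4 : (0 : ℝ) < (Fintype.card V : ℝ) ^ q := by positivity
    rw [hq] at h𝒯 h3 hV
    simp only [Nat.add_sub_cancel] at h3
    rw [pow_succ] at h𝒯
    nlinarith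

theorem card_forall_exists_rel_ge {X : Type*} [Fintype X] (R : X → X → Prop) {δ : ℝ}
    (hR : ∀ x, δ * Fintype.card X ≤ (Finset.univ.filter (R x)).card) {M : ℕ}
    (hM : M * (1 - δ) ^ (M - 1) ≤ 1 / 2) :
    1 / 2 * (Fintype.card X : ℝ) ^ M ≤ (Finset.univ.filter fun x : Fin M → X =>
      ∀ i, ∃ j, j ≠ i ∧ R (x i) (x j)).card := by
  set N : ℝ := (Fintype.card X : ℝ) with hN
  let G := Finset.univ.filter fun x : Fin M → X => ∀ i, ∃ j, j ≠ i ∧ R (x i) (x j)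
  let P : Fin M → X → Finset (Fin M → X) := fun i y => Fintype.piFinset fun j =>
    if j = i then {y} else Finset.univ.filter fun z => ¬ R y z
  have hP : ∀ i y, ((P i y).card : ℝ) ≤ ((1 - δ) * N) ^ (M - 1) := by
    intro i y
    have h1 : (P i y).card = (Finset.univ.filter fun z => ¬ R y z).card ^ (M - 1) := by
      rw [Fintype.card_piFinset, ← Finset.mul_prod_erase _ _ (Finset.mem_univ i)]
      rw [Finset.prod_congr rfl (g := fun _ => (Finset.univ.filter fun z => ¬ R y z).card)]
      · simp
      · intro j hj
        rw [if_neg (Finset.ne_of_mem_erase hj)]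
    rw [h1]
    push_cast
    refine pow_le_pow_left₀ (by positivity) ?_ _
    have h2 := Finset.card_filter_add_card_filter_not (s := (Finset.univ : Finset X)) (R y)
    have h3 : ((Finset.univ.filter (R y)).card : ℝ) +
        (Finset.univ.filter fun z => ¬ R y z).card = N := by
      rw [hN, ← Finset.card_univ]; exact_mod_cast h2
    have := hR y
    linarith
  have hcov : Gᶜ ⊆ (Finset.univ : Finset (Fin M × X)).biUnion fun q => P q.1 q.2 := by
    intro x hx
    simp only [G, Finset.mem_compl, Finset.mem_filter, Finset.mem_univ, true_and, not_forall,
      not_exists, not_and] at hx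
    obtain ⟨i, hi⟩ := hx
    simp only [Finset.mem_biUnion, Finset.mem_univ, true_and]
    refine ⟨(i, x i), Fintype.mem_piFinset.2 fun j => ?_⟩
    by_cases hj : j = i
    · simp [hj]
    · simpa [hj] using hi j hj
  have h1 : (Gᶜ.card : ℝ) ≤ ∑ q : Fin M × X, ((P q.1 q.2).card : ℝ) := by
    exact_mod_cast (Finset.card_le_card hcov).trans Finset.card_biUnion_le
  have h2 : (Gᶜ.card : ℝ) ≤ M * N * ((1 - δ) * N) ^ (M - 1) := by
    refine h1.trans ((Finset.sum_le_sum fun q _ => hP q.1 q.2).trans (le_of_eq ?_))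
    simp [hN]
  have h3 : (G.card : ℝ) + Gᶜ.card = N ^ M := by
    have := Finset.card_add_card_compl G
    rw [hN]
    exact_mod_cast this.trans (by simp)
  have h4 : M * N * ((1 - δ) * N) ^ (M - 1) ≤ 1 / 2 * N ^ M := by
    rcases Nat.eq_zero_or_pos M with rfl | h0
    · simp
    · obtain ⟨q, rfl⟩ : ∃ q, M = q + 1 := ⟨_, (Nat.succ_pred_eq_of_pos h0).symm⟩
      have : 0 ≤ N ^ (q + 1) := by positivity
      calc ((q + 1 : ℕ) : ℝ) * N * ((1 - δ) * N) ^ (q + 1 - 1)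
          = (((q + 1 : ℕ) : ℝ) * (1 - δ) ^ (q + 1 - 1)) * N ^ (q + 1) := by
            rw [Nat.add_sub_cancel, mul_pow, pow_succ]; ring
        _ ≤ _ := mul_le_mul_of_nonneg_right hM this
  change _ ≤ (G.card : ℝ)
  linarith

theorem hasCopy_image_equiv_iff {α β γ : Type*} [DecidableEq α] [DecidableEq β] [DecidableEq γ]
    (σ : α ≃ β) (F : Finset (Finset α)) (E : Finset (Finset γ)) :
    HasCopy (F.image fun e => e.image σ) E ↔ HasCopy F E := by
  constructor
  · rintro ⟨f, hf, h⟩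
    refine ⟨f ∘ σ, hf.comp σ.injective, fun e he => ?_⟩
    rw [← Finset.image_image]
    exact h _ (Finset.mem_image_of_mem _ he)
  · rintro ⟨f, hf, h⟩
    refine ⟨f ∘ σ.symm, hf.comp σ.symm.injective, fun e he => ?_⟩
    obtain ⟨e', he', rfl⟩ := Finset.mem_image.1 he
    rw [Finset.image_image, Function.comp_assoc, Equiv.symm_comp_self, Function.comp_id]
    exact h e' he'

theorem succ_mod_ne {ℓ : ℕ} (hℓ : 2 ≤ ℓ) (i : ℕ) (hi : i < ℓ) : (i + 1) % ℓ ≠ i := by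
  rcases Nat.lt_or_ge (i + 1) ℓ with h | h
  · rw [Nat.mod_eq_of_lt h]; omega
  · obtain rfl : ℓ = i + 1 := by omega
    simp; omega

theorem notMem_row {k ℓ : ℕ} (hℓ : 2 ≤ ℓ) (i : Fin ℓ) (j : Fin (k - 1)) :
    ((⟨(i.val + 1) % ℓ, Nat.mod_lt _ i.pos⟩, j) : Fin ℓ × Fin (k - 1)) ∉
      Finset.univ.image fun j : Fin (k - 1) => (i, j) := by
  simp only [Finset.mem_image, Finset.mem_univ, true_and, not_exists, Prod.mk.injEq, not_and]
  intro _ h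
  exact absurd (congrArg Fin.val h).symm (succ_mod_ne hℓ i i.2)

theorem card_of_mem_zycle {k ℓ : ℕ} (hk : 1 ≤ k) (hℓ : 2 ≤ ℓ) {e : Finset (Fin ℓ × Fin (k - 1))}
    (he : e ∈ zycle k ℓ) : e.card = k := by
  obtain ⟨⟨i, j⟩, -, rfl⟩ := Finset.mem_image.1 he
  rw [Finset.card_insert_of_notMem (notMem_row hℓ i j),
    Finset.card_image_of_injective _ (Prod.mk_right_injective i)]
  simp; omega

/-- The `k`-subsets of `Fin n` whose elements sum to `1` modulo `m`. -/
def sumOneEdges (k m n : ℕ) : Finset (Finset (Fin n)) :=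
  Finset.univ.filter fun e => e.card = k ∧ ∑ v ∈ e, ((v : ℕ) : ZMod m) = 1

theorem one_sub_pow_ne_one {k ℓ : ℕ} (hk : 3 ≤ k) (hℓ : 2 ≤ ℓ) :
    (1 - (k : ZMod (k ^ (ℓ + 1)))) ^ ℓ ≠ 1 := by
  intro h
  have hdvd : ((k ^ (ℓ + 1) : ℕ) : ℤ) ∣ (1 - (k : ℤ)) ^ ℓ - 1 := by
    rw [← ZMod.intCast_zmod_eq_zero_iff_dvd]
    push_cast
    rw [h, sub_self]
  obtain ⟨q, rfl⟩ : ∃ q, k = q + 1 := ⟨k - 1, by omega⟩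
  have habs : |(1 - ((q + 1 : ℕ) : ℤ)) ^ ℓ| = (q : ℤ) ^ ℓ := by
    rw [abs_pow]; congr 1; push_cast; rw [show (1 - ((q : ℤ) + 1)) = -q by ring]; simp
  have hlow : (1 : ℤ) < (q : ℤ) ^ ℓ :=
    one_lt_pow₀ (by exact_mod_cast (by omega : 1 < q)) (by omega)
  have hup : (q : ℤ) ^ ℓ ≤ ((q : ℤ) + 1) ^ ℓ := pow_le_pow_left₀ (by positivity) (by linarith) _
  have hq : (2 : ℤ) ≤ q := by exact_mod_cast (by omega : 2 ≤ q)
  have hz := Int.eq_zero_of_abs_lt_dvd hdvd (by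
    refine (abs_sub _ _).trans_lt ?_
    rw [habs]
    push_cast
    rw [pow_succ]
    simp only [abs_one]
    nlinarith)
  have : (1 - ((q + 1 : ℕ) : ℤ)) ^ ℓ = 1 := by linarith
  rw [this] at habs
  simp at habs
  linarith

theorem not_hasCopy_zycle_sumOneEdges {k ℓ n : ℕ} (hk : 3 ≤ k) (hℓ : 2 ≤ ℓ) :
    ¬ HasCopy (zycle k ℓ) (sumOneEdges k (k ^ (ℓ + 1)) n) := by
  rintro ⟨f, hf, h⟩
  have hℓ0 : 0 < ℓ := by omega
  let S : ℕ → ZMod (k ^ (ℓ + 1)) := fun i =>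
    ∑ j : Fin (k - 1), ((f (⟨i % ℓ, Nat.mod_lt _ hℓ0⟩, j) : ℕ) : ZMod (k ^ (ℓ + 1)))
  have hedge : ∀ (i : ℕ) (j : Fin (k - 1)),
      ((f (⟨(i + 1) % ℓ, Nat.mod_lt _ hℓ0⟩, j) : ℕ) : ZMod (k ^ (ℓ + 1))) + S i = 1 := by
    intro i j
    have hmem := h _ (Finset.mem_image_of_mem _
      (Finset.mem_univ ((⟨i % ℓ, Nat.mod_lt _ hℓ0⟩, j) : Fin ℓ × Fin (k - 1))))
    have hsum := ((Finset.mem_filter.1 hmem).2).2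
    rw [Finset.sum_image hf.injOn, Finset.sum_insert (notMem_row hℓ _ j),
      Finset.sum_image (Prod.mk_right_injective _).injOn] at hsum
    simpa only [Nat.mod_add_mod] using hsum
  have hk1 : (((k - 1 : ℕ) : ℕ) : ZMod (k ^ (ℓ + 1))) = (k : ZMod (k ^ (ℓ + 1))) - 1 := by
    rw [Nat.cast_sub (by omega)]; simp
  have hstep : ∀ i, S (i + 1) + (k - 1) * S i = k - 1 := by
    intro i
    have := Finset.sum_congr (rfl : (Finset.univ : Finset (Fin (k - 1))) = Finset.univ)
      (fun j _ => hedge i j)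
    rw [Finset.sum_add_distrib] at this
    simp only [Finset.sum_const, Finset.card_univ, Fintype.card_fin, nsmul_eq_mul, hk1,
      mul_one] at this
    exact this
  have hpow : ∀ i, k * S i - (k - 1) = (1 - (k : ZMod (k ^ (ℓ + 1)))) ^ i * (k * S 0 - (k - 1)) := by
    intro i
    induction i with
    | zero => simp
    | succ i ih =>
      linear_combination
        (k : ZMod (k ^ (ℓ + 1))) * hstep i + (1 - (k : ZMod (k ^ (ℓ + 1)))) * ih
  have hper : S ℓ = S 0 := by simp [S]
  have hunit : IsUnit ((k : ZMod (k ^ (ℓ + 1))) * S 0 - (k - 1)) := by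
    have hnil : IsNilpotent ((k : ZMod (k ^ (ℓ + 1))) * (S 0 - 1)) := by
      refine ⟨ℓ + 1, ?_⟩
      rw [mul_pow]
      have : (k : ZMod (k ^ (ℓ + 1))) ^ (ℓ + 1) = 0 := by
        exact_mod_cast ZMod.natCast_self (k ^ (ℓ + 1))
      rw [this, zero_mul]
    convert hnil.isUnit_one_add using 1
    ring
  have := hpow ℓ
  rw [hper] at this
  exact one_sub_pow_ne_one hk hℓ (hunit.mul_right_cancel (by rw [one_mul]; exact this.symm))

theorem le_hdeg_sumOneEdges {k m n : ℕ} (hk : 1 ≤ k) (hm : 0 < m) (s : Finset (Fin n))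
    (hs : s.card = k - 1) : n / m - (k - 1) ≤ hdeg (sumOneEdges k m n) s := by
  have : NeZero m := ⟨hm.ne'⟩
  let r : ZMod m := 1 - ∑ v ∈ s, ((v : ℕ) : ZMod m)
  let C : Finset (Fin n) := Finset.univ.filter fun v => ((v : ℕ) : ZMod m) = r
  have hC : n / m ≤ C.card := by
    have hlt : ∀ q : Fin (n / m), (q : ℕ) * m + r.val < n := by
      intro q
      have h1 : ((q : ℕ) + 1) * m ≤ n / m * m := Nat.mul_le_mul_right _ q.2
      have h2 := Nat.div_mul_le_self n m
      have h3 := ZMod.val_lt r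
      nlinarith
    rw [← Fintype.card_fin (n / m), ← Finset.card_univ]
    refine Finset.card_le_card_of_injOn (fun q => ⟨(q : ℕ) * m + r.val, hlt q⟩) ?_ ?_
    · intro q _
      simp [C]
    · intro q _ q' _ h
      have := congrArg Fin.val h
      simp only [Nat.add_right_cancel_iff] at this
      exact Fin.ext (Nat.eq_of_mul_eq_mul_right hm this)
  refine le_trans (Nat.sub_le_sub_right hC _) ?_
  rw [← hs]
  refine (Finset.le_card_sdiff _ _).trans ?_
  refine Finset.card_le_card_of_injOn (fun v => insert v s) ?_ ?_
  · intro v hv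
    simp only [C, Finset.coe_sdiff, Set.mem_sdiff, Finset.mem_coe, Finset.mem_filter,
      Finset.mem_univ, true_and] at hv
    simp only [sumOneEdges, Finset.coe_filter, Set.mem_ofPred_eq, Finset.mem_filter,
      Finset.mem_univ, true_and, Finset.subset_insert, and_true]
    rw [Finset.card_insert_of_notMem hv.2, Finset.sum_insert hv.2, hv.1]
    exact ⟨by omega, by simp [r]⟩
  · intro v hv v' hv' h
    simp only [Finset.coe_sdiff, Set.mem_sdiff, Finset.mem_coe] at hv hv'
    have : v ∈ insert v' s := by
      rw [← show insert v s = insert v' s from h]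
      exact Finset.mem_insert_self v s
    exact (Finset.mem_insert.1 this).resolve_right hv.2

theorem le_exco {α : Type*} {k n d : ℕ} {F : Finset (Finset α)} (hn : k ≤ n)
    {E : Finset (Finset (Fin n))} (hE : ∀ e ∈ E, e.card = k) (hF : ¬ HasCopy F E)
    (hd : ∀ s : Finset (Fin n), s.card = k - 1 → d ≤ hdeg E s) : d ≤ exco k n F := by
  refine le_csSup ⟨Fintype.card (Finset (Fin n)), ?_⟩ ⟨E, hE, hF, hd⟩
  rintro d' ⟨E', -, -, h⟩
  obtain ⟨s, -, hs⟩ := Finset.exists_subset_card_eq (s := (Finset.univ : Finset (Fin n)))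
    (n := k - 1) (by simp; omega)
  exact (h s hs).trans (Finset.card_le_univ _)

theorem exco_le {α : Type*} {k n : ℕ} {F : Finset (Finset α)} {b : ℝ} (hb : 0 ≤ b)
    (h : ∀ E : Finset (Finset (Fin n)), (∀ e ∈ E, e.card = k) →
      (∀ s : Finset (Fin n), s.card = k - 1 → b ≤ hdeg E s) → HasCopy F E) :
    (exco k n F : ℝ) ≤ b := by
  refine le_trans (Nat.cast_le.2 (csSup_le' (a := ⌊b⌋₊) ?_)) (Nat.floor_le hb)
  rintro d ⟨E, hE, hF, hd⟩
  by_contra hlt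
  refine hF (h E hE fun s hs => ?_)
  have h1 := Nat.lt_of_floor_lt (not_le.1 hlt)
  exact h1.le.trans (by exact_mod_cast hd s hs)

theorem hdeg_le_card_filter {α : Type*} [Fintype α] [DecidableEq α] {k : ℕ} (hk : 1 ≤ k)
    {E : Finset (Finset α)} (hE : ∀ e ∈ E, e.card = k) {s : Finset α} (hs : s.card = k - 1) :
    hdeg E s ≤ (Finset.univ.filter fun v => insert v s ∈ E).card := by
  refine (Finset.card_le_card ?_).trans
    (Finset.card_image_le (f := fun v => insert v s))
  intro e he
  obtain ⟨heE, hse⟩ := Finset.mem_filter.1 he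
  obtain ⟨v, hv⟩ : ∃ v, e \ s = {v} := by
    rw [← Finset.card_eq_one, Finset.card_sdiff_of_subset hse, hE e heE]; omega
  have hvs : insert v s = e := by
    rw [Finset.insert_eq, ← hv, Finset.sdiff_union_of_subset hse]
  exact Finset.mem_image.2 ⟨v, by simpa [hvs] using heE, hvs⟩

theorem exists_large_fixed_choice {X : Type*} [Fintype X] (R : X → X → Prop) {M : ℕ} {c : ℝ}
    (h : c * (Fintype.card X : ℝ) ^ M ≤ (Finset.univ.filter fun x : Fin M → X =>
      ∀ i, ∃ j, j ≠ i ∧ R (x i) (x j)).card) :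
    ∃ g : Fin M → Fin M, c / (M : ℝ) ^ M * (Fintype.card X : ℝ) ^ M ≤
      (Finset.univ.filter fun x : Fin M → X => ∀ i, g i ≠ i ∧ R (x i) (x (g i))).card := by
  by_contra! hcon
  have hsub : (Finset.univ.filter fun x : Fin M → X => ∀ i, ∃ j, j ≠ i ∧ R (x i) (x j)) ⊆
      (Finset.univ : Finset (Fin M → Fin M)).biUnion fun g =>
        Finset.univ.filter fun x : Fin M → X => ∀ i, g i ≠ i ∧ R (x i) (x (g i)) := by
    intro x hx
    simp only [Finset.mem_filter, Finset.mem_univ, true_and] at hx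
    choose g hg using hx
    exact Finset.mem_biUnion.2 ⟨g, Finset.mem_univ _, by simpa using hg⟩
  have h1 := (Finset.card_le_card hsub).trans Finset.card_biUnion_le
  have h2 := Finset.sum_lt_sum_of_nonempty (s := (Finset.univ : Finset (Fin M → Fin M)))
    ⟨id, Finset.mem_univ _⟩ fun g _ => hcon g
  have h3 : (M : ℝ) ^ M ≠ 0 := by
    rcases Nat.eq_zero_or_pos M with rfl | h0
    · simp
    · positivity
  simp only [Finset.sum_const, Finset.card_univ, Fintype.card_fun, Fintype.card_fin,
    nsmul_eq_mul, Nat.cast_pow] at h2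
  rw [← mul_assoc, mul_div_cancel₀ _ h3] at h2
  have h4 : ((Finset.univ.filter fun x : Fin M → X =>
      ∀ i, ∃ j, j ≠ i ∧ R (x i) (x j)).card : ℝ) ≤ ∑ g : Fin M → Fin M,
      ((Finset.univ.filter fun x : Fin M → X => ∀ i, g i ≠ i ∧ R (x i) (x (g i))).card : ℝ) := by
    exact_mod_cast h1
  linarith

theorem exists_closed_walk_factorial {M : ℕ} (hM : 0 < M) (g : Fin M → Fin M) :
    ∃ w : Fin M, g^[M.factorial] w = w := by
  have hM' : NeZero M := ⟨hM.ne'⟩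
  obtain ⟨a, b, hab, h⟩ : ∃ a b : Fin (M + 1), a < b ∧ g^[a] 0 = g^[b] 0 := by
    obtain ⟨a, b, hab, h⟩ := Fintype.exists_ne_map_eq_of_card_lt
      (fun a : Fin (M + 1) => g^[a] 0) (by simp)
    rcases lt_or_gt_of_ne hab with h' | h'
    · exact ⟨a, b, h', h⟩
    · exact ⟨b, a, h', h.symm⟩
  refine ⟨g^[a] 0, ?_⟩
  have hab' : (a : ℕ) < b := hab
  have hper : Function.IsPeriodicPt g (b - a : ℕ) (g^[a] 0) := by
    change g^[(b - a : ℕ)] (g^[a] 0) = g^[a] 0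
    rw [← Function.iterate_add_apply, Nat.sub_add_cancel hab'.le, h]
  exact hper.trans_dvd (Nat.dvd_factorial (by omega) (by omega))

theorem hasCopy_zycle_of_blowup {k ℓ n M : ℕ} (E : Finset (Finset (Fin n)))
    (g : Fin M → Fin M) (w : Fin M) (hw : g^[ℓ] w = w)
    (T : Fin M → Fin ℓ → Fin (k - 1) → Fin n)
    (hT : ∀ i s s' a, insert (T (g i) s' a) (Finset.univ.image (T i s)) ∈ E)
    (hinj : Function.Injective fun q : Fin M × Fin ℓ × Fin (k - 1) => T q.1 q.2.1 q.2.2) :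
    HasCopy (zycle k ℓ) E := by
  refine ⟨fun p => T (g^[p.1] w) p.1 p.2, ?_, ?_⟩
  · rintro ⟨i, a⟩ ⟨j, b⟩ h
    have := @hinj (g^[i] w, i, a) (g^[j] w, j, b) h
    simp only [Prod.mk.injEq] at this ⊢
    exact this.2
  · intro e he
    obtain ⟨⟨i, a⟩, -, rfl⟩ := Finset.mem_image.1 he
    rw [Finset.image_insert, Finset.image_image]
    have hnext : g^[((i : ℕ) + 1) % ℓ] w = g (g^[i] w) := by
      have : Function.IsPeriodicPt g ℓ w := hw
      rw [this.iterate_mod_apply, Function.iterate_succ_apply']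
    simp only [hnext]
    exact hT _ _ _ _

theorem exists_self_mul_pow_le {r : ℝ} (hr0 : 0 ≤ r) (hr1 : r < 1) :
    ∃ M : ℕ, 2 ≤ M ∧ M * r ^ (M - 1) ≤ 1 / 2 := by
  have h := (tendsto_self_mul_const_pow_of_lt_one hr0 hr1).eventually
    (gt_mem_nhds (show (0 : ℝ) < 1 / 4 by norm_num))
  obtain ⟨q, hq, hq1⟩ := (h.and (Filter.eventually_ge_atTop 1)).exists
  refine ⟨q + 1, by omega, ?_⟩
  have h1 : (1 : ℝ) ≤ q := by exact_mod_cast hq1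
  have h2 : 0 ≤ r ^ q := by positivity
  rw [Nat.add_sub_cancel]
  push_cast
  nlinarith

/-- The extension relation between ordered `(k-1)`-tuples: every extension of the entries of `x` by
an entry of `y` is an edge. Tuples with a repeated entry are related to everything. -/
def TupleTri {k n : ℕ} (E : Finset (Finset (Fin n))) (x y : Fin (k - 1) → Fin n) : Prop :=
  Function.Injective x → ∀ a, insert (y a) (Finset.univ.image x) ∈ E

theorem card_tupleTri_ge {k n : ℕ} (hk : 1 ≤ k) {ε : ℝ} (hε : 0 ≤ ε) (hε1 : ε ≤ 1)
    {E : Finset (Finset (Fin n))} (hE : ∀ e ∈ E, e.card = k)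
    (hdeg : ∀ s : Finset (Fin n), s.card = k - 1 → ε * n ≤ hdeg E s) (x : Fin (k - 1) → Fin n) :
    ε ^ (k - 1) * Fintype.card (Fin (k - 1) → Fin n) ≤
      (Finset.univ.filter (TupleTri E x)).card := by
  by_cases hx : Function.Injective x
  · have hs : (Finset.univ.image x).card = k - 1 := by
      rw [Finset.card_image_of_injective _ hx]; simp
    have h1 : Finset.univ.filter (TupleTri E x) = Fintype.piFinset fun _ : Fin (k - 1) =>
        Finset.univ.filter fun v => insert v (Finset.univ.image x) ∈ E := by
      ext y
      simp [TupleTri, hx]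
    rw [h1, Fintype.card_piFinset_const, Fintype.card_fun, Fintype.card_fin, Fintype.card_fin]
    push_cast
    rw [← mul_pow]
    refine pow_le_pow_left₀ (by positivity) ((hdeg _ hs).trans ?_) _
    exact_mod_cast hdeg_le_card_filter hk hE hs
  · have h1 : Finset.univ.filter (TupleTri E x) = Finset.univ := by
      ext y
      simp [TupleTri, hx]
    rw [h1, Finset.card_univ]
    exact mul_le_of_le_one_left (by positivity) (pow_le_one₀ hε hε1)

theorem exists_hasCopy_zycle {k : ℕ} (hk : 2 ≤ k) {ε : ℝ} (hε : 0 < ε) (hε1 : ε ≤ 1) :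
    ∃ ℓ : ℕ, 2 ≤ ℓ ∧ ∃ n₀ : ℕ, ∀ n ≥ n₀, ∀ E : Finset (Finset (Fin n)),
      (∀ e ∈ E, e.card = k) →
      (∀ s : Finset (Fin n), s.card = k - 1 → ε * n ≤ hdeg E s) → HasCopy (zycle k ℓ) E := by
  have hδ0 : 0 < ε ^ (k - 1) := by positivity
  have hδ1 : ε ^ (k - 1) ≤ 1 := pow_le_one₀ hε.le hε1
  obtain ⟨M, hM2, hM⟩ := exists_self_mul_pow_le (r := 1 - ε ^ (k - 1)) (by linarith) (by linarith)
  set ℓ := M.factorial with hℓ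
  have hℓ2 : 2 ≤ ℓ := hM2.trans (Nat.self_le_factorial M)
  set c : ℝ := 1 / 2 / (M : ℝ) ^ M with hc
  have hM0 : (0 : ℝ) < M := by exact_mod_cast (by omega : 0 < M)
  have hc0 : 0 < c := by positivity
  let I := Fin M × Fin ℓ × Fin (k - 1)
  have hc' : 0 < c ^ ℓ ^ M := by positivity
  obtain ⟨n₀, hn₀⟩ := exists_nat_gt ((Fintype.card I : ℝ) ^ 2 / c ^ ℓ ^ M)
  refine ⟨ℓ, hℓ2, n₀, fun n hn E hE hdeg => ?_⟩
  obtain ⟨g, hg⟩ := exists_large_fixed_choice _ (card_forall_exists_rel_ge (TupleTri E)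
    (card_tupleTri_ge (by omega) hε.le hε1 hE hdeg) hM)
  have hblow := card_blowup_ge (t := ℓ) (by omega) M _ hc0.le hg
  let u : (Fin M → Fin ℓ → Fin (k - 1) → Fin n) → I → Fin n := fun T q => T q.1 q.2.1 q.2.2
  have hu : Function.Injective u := fun T T' h => by
    funext i s a
    exact congrFun h (i, s, a)
  rw [← Finset.card_image_of_injective _ hu] at hblow
  have hcard : (Fintype.card (Fin (k - 1) → Fin n) : ℝ) ^ (M * ℓ) =
      (Fintype.card (Fin n) : ℝ) ^ Fintype.card I := by
    simp only [I, Fintype.card_prod, Fintype.card_fin, Fintype.card_fun, Nat.cast_pow]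
    ring
  rw [hcard] at hblow
  obtain ⟨f, hf, hinj⟩ := exists_injective_of_card_lt _ hc' hblow (by
    rw [div_lt_iff₀ hc'] at hn₀
    rw [Fintype.card_fin]
    have : (n₀ : ℝ) ≤ n := by exact_mod_cast hn
    nlinarith)
  obtain ⟨T, hT, rfl⟩ := Finset.mem_image.1 hf
  simp only [Finset.mem_filter, Finset.mem_univ, true_and] at hT
  obtain ⟨w, hw⟩ := exists_closed_walk_factorial (by omega : 0 < M) g
  refine hasCopy_zycle_of_blowup E g w hw T (fun i s s' a => ?_) hinj
  have hgi := (hT (fun _ => s) i).1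
  have h1 := (hT (fun j => if j = i then s else s') i).2
  simp only [if_true, if_neg hgi] at h1
  refine h1 (fun b b' h => ?_) a
  have hq := @hinj (i, s, b) (i, s, b') h
  exact (Prod.mk.inj (Prod.mk.inj hq).2).2

/-- For every real `ξ > 0` and every integer `k ≥ 3`, there exists a `k`-uniform
hypergraph `F` whose codegree Turán density satisfies `0 < γ(F) < ξ`. -/
theorem statement0 (ξ : ℝ) (hξ : 0 < ξ) (k : ℕ) (hk : 3 ≤ k) :
    ∃ (m : ℕ) (F : Finset (Finset (Fin m))), (∀ e ∈ F, e.card = k) ∧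
      0 < codegTuranDensity k F ∧ codegTuranDensity k F < ξ := by
  set ε : ℝ := min (ξ / 2) 1 with hε
  have hε0 : 0 < ε := lt_min (by linarith) one_pos
  obtain ⟨ℓ, hℓ, n₀, hn₀⟩ := exists_hasCopy_zycle (k := k) (by omega) hε0 (min_le_right _ _)
  let σ : Fin ℓ × Fin (k - 1) ≃ Fin (ℓ * (k - 1)) := finProdFinEquiv
  let F : Finset (Finset (Fin (ℓ * (k - 1)))) := (zycle k ℓ).image fun e => e.image σ
  set m := k ^ (ℓ + 1) with hm
  have hm0 : 0 < m := by positivity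
  have hmR : (0 : ℝ) < m := by exact_mod_cast hm0
  have hup : ∀ᶠ n : ℕ in Filter.atTop, (exco k n F : ℝ) / n ≤ ε := by
    filter_upwards [Filter.eventually_ge_atTop n₀, Filter.eventually_gt_atTop 0] with n hn hn1
    have hn1' : (0 : ℝ) < n := by exact_mod_cast hn1
    rw [div_le_iff₀ hn1']
    exact exco_le (by positivity) fun E hE hd =>
      (hasCopy_image_equiv_iff σ _ E).2 (hn₀ n hn E hE hd)
  have hlow : ∀ᶠ n : ℕ in Filter.atTop, 1 / (2 * (m : ℝ)) ≤ (exco k n F : ℝ) / n := by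
    filter_upwards [Filter.eventually_ge_atTop (2 * m * k)] with n hn
    have hkn : k ≤ n := le_trans (Nat.le_mul_of_pos_left k (by omega)) hn
    have hn1' : (0 : ℝ) < n := by exact_mod_cast (by omega : 0 < n)
    have h1 : n / m - (k - 1) ≤ exco k n F := by
      refine le_exco hkn (E := sumOneEdges k m n) (fun e he => ((Finset.mem_filter.1 he).2).1) ?_
        fun s hs => le_hdeg_sumOneEdges (by omega) hm0 s hs
      rw [hasCopy_image_equiv_iff]
      exact not_hasCopy_zycle_sumOneEdges hk hℓ
    have h2 : n < (exco k n F + k) * m := by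
      rw [← Nat.div_lt_iff_lt_mul hm0]
      omega
    have h3 : (n : ℝ) < (exco k n F + k) * m := by exact_mod_cast h2
    have h4 : 2 * (m : ℝ) * k ≤ n := by exact_mod_cast hn
    rw [le_div_iff₀ hn1', div_mul_eq_mul_div, one_mul, div_le_iff₀ (by positivity)]
    linarith
  refine ⟨ℓ * (k - 1), F, ?_, ?_, ?_⟩
  · intro e he
    obtain ⟨e', he', rfl⟩ := Finset.mem_image.1 he
    rw [Finset.card_image_of_injective _ σ.injective]
    exact card_of_mem_zycle (by omega) hℓ he'
  · refine lt_of_lt_of_le (by positivity : (0 : ℝ) < 1 / (2 * (m : ℝ))) ?_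
    exact Filter.le_limsup_of_frequently_le hlow.frequently
      (Filter.isBoundedUnder_of_eventually_le hup)
  · refine lt_of_le_of_lt (Filter.limsup_le_of_le
      (Filter.isCoboundedUnder_le_of_eventually_le _ hlow) hup) ?_
    exact (min_le_left _ _).trans_lt (by linarith)
end

section
/- Let ℓ ≥ 3 be an integer and let Z_ℓ^{(3)−} be the 3-uniform hypergraph obtained from Z_ℓ^{(3)} by deleting one edge (all edges of Z_ℓ^{(3)} are equivalent under automorphisms, so one may delete the edge {v_1^1, v_1^2, v_2^1}). Then γ(Z_ℓ^{(3)−}) = 0; equivalently, for every ε > 0 there exists n_0 such that every 3-uniform hypergraph H on n ≥ n_0 vertices with minimum codegree δ(H) ≥ εn contains a copy of Z_ℓ^{(3)−}. -/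
open Finset

open scoped Classical

/-- `Z_ℓ^{(3)−}`: the 3-uniform zycle of length `ℓ` with the edge
`{v_1^1, v_1^2, v_2^1} = {(0,0), (0,1), (1,0)}` deleted. -/
def zycleMinus (ℓ : ℕ) (hℓ : 0 < ℓ) : Finset (Finset (Fin ℓ × Fin 2)) :=
  (zycle 3 ℓ).erase
    (insert ((⟨1 % ℓ, Nat.mod_lt _ hℓ⟩ : Fin ℓ), (0 : Fin 2))
      (Finset.univ.image fun j : Fin 2 => ((⟨0, hℓ⟩ : Fin ℓ), j)))

lemma vecPair_eq_or {α : Type*} (a b : α) (j : Fin 2) : ![a, b] j = a ∨ ![a, b] j = b := by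
  fin_cases j <;> simp

lemma vecPair_injective {α : Type*} {a b : α} (hab : a ≠ b) : Function.Injective ![a, b] := by
  intro j j' h
  fin_cases j <;> fin_cases j' <;> simp_all [eq_comm]

section Codegree

variable {V : Type*} [Fintype V] [DecidableEq V]

/-- The vertices forming an edge of `E` together with `x` and `y`. -/
def conbr (E : Finset (Finset V)) (x y : V) : Finset V :=
  Finset.univ.filter fun z => ({x, y, z} : Finset V) ∈ E

lemma mem_conbr {E : Finset (Finset V)} {x y z : V} :
    z ∈ conbr E x y ↔ ({x, y, z} : Finset V) ∈ E := by
  simp [conbr]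

lemma conbr_rotate {E : Finset (Finset V)} {x y z : V} (h : z ∈ conbr E x y) :
    x ∈ conbr E y z := by
  rw [mem_conbr] at h ⊢
  rwa [show ({y, z, x} : Finset V) = {x, y, z} by ext; simp; tauto]

lemma ne_of_mem_conbr {E : Finset (Finset V)} (hE : ∀ e ∈ E, e.card = 3) {x y z : V}
    (h : z ∈ conbr E x y) : x ≠ y ∧ z ≠ x ∧ z ≠ y := by
  have h3 := hE _ (mem_conbr.1 h)
  have key : ∀ a b : V, ({a, b} : Finset V).card ≠ 3 := fun a b hab => by
    have := Finset.card_le_two (a := a) (b := b)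
    omega
  refine ⟨?_, ?_, ?_⟩ <;> rintro rfl
  · exact key x z (by simpa using h3)
  · exact key z y (by rw [← h3]; congr 1; ext; simp; tauto)
  · exact key x z (by simpa using h3)

lemma hdeg_pair_le {E : Finset (Finset V)} (hE : ∀ e ∈ E, e.card = 3) {x y : V} (hxy : x ≠ y) :
    hdeg E {x, y} ≤ (conbr E x y).card := by
  refine (Finset.card_le_card (t := (conbr E x y).image fun z => ({x, y, z} : Finset V)) ?_).trans
    Finset.card_image_le
  intro e he
  obtain ⟨heE, hsub⟩ := Finset.mem_filter.1 he
  have hc : (e \ {x, y}).card = 1 := by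
    rw [Finset.card_sdiff_of_subset hsub, hE e heE, Finset.card_pair hxy]
  obtain ⟨z, hz⟩ := Finset.card_eq_one.1 hc
  have hez : ({x, y, z} : Finset V) = e := by
    rw [← Finset.sdiff_union_of_subset hsub, hz]
    ext
    simp
    tauto
  exact Finset.mem_image.2 ⟨z, mem_conbr.2 (hez ▸ heE), hez⟩

/-- Greedy construction of a sequence of `k + 1` disjoint pairs, each extended to edges by both
vertices of the next one, starting from a given pair and avoiding a given set. -/
lemma exists_pair_path {E : Finset (Finset V)} {d : ℕ}
    (hd : ∀ x y : V, x ≠ y → d ≤ (conbr E x y).card) (k : ℕ) :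
    ∀ (X : Finset V) (p q : V), p ≠ q → p ∉ X → q ∉ X → X.card + 2 * k + 2 ≤ d →
      ∃ g : ℕ → Fin 2 → V, g 0 = ![p, q] ∧
        (∀ i ≤ k, ∀ j, g i j ∉ X) ∧
        (∀ i ≤ k, ∀ i' ≤ k, ∀ j j', g i j = g i' j' → i = i' ∧ j = j') ∧
        ∀ i < k, ∀ j, g (i + 1) j ∈ conbr E (g i 0) (g i 1) := by
  induction k with
  | zero =>
    intro X p q hpq hp hq _
    refine ⟨fun _ => ![p, q], rfl, ?_, ?_, by simp⟩
    · intro i _ j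
      fin_cases j <;> simpa
    · intro i hi i' hi' j j' h
      exact ⟨by omega, vecPair_injective hpq h⟩
  | succ k ih =>
    intro X p q hpq hp hq hX
    have hY : (insert p (insert q X)).card = X.card + 2 := by
      rw [Finset.card_insert_of_notMem (by simp [hpq, hp]), Finset.card_insert_of_notMem hq]
    have h2 : 1 < (conbr E p q \ insert p (insert q X)).card := by
      have := Finset.le_card_sdiff (insert p (insert q X)) (conbr E p q)
      have := hd p q hpq
      omega
    obtain ⟨r, hr, s, hs, hrs⟩ := Finset.one_lt_card.1 h2
    rw [Finset.mem_sdiff] at hr hs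
    obtain ⟨g, hg0, hgX, hgi, hge⟩ := ih _ r s hrs hr.2 hs.2 (by omega)
    have hnew : ∀ i ≤ k, ∀ j j', g i j ≠ ![p, q] j' := by
      intro i hi j j' h
      refine hgX i hi j ?_
      rw [h]
      fin_cases j' <;> simp
    refine ⟨fun i => Nat.casesOn i ![p, q] g, rfl, ?_, ?_, ?_⟩
    · rintro (_ | i) hi j
      · fin_cases j <;> simpa
      · have := hgX i (by omega) j
        simp only [Finset.mem_insert, not_or] at this
        exact this.2.2
    · rintro (_ | i) hi (_ | i') hi' j j' h
      · exact ⟨rfl, vecPair_injective hpq h⟩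
      · exact absurd h.symm (hnew i' (by omega) _ _)
      · exact absurd h (hnew i (by omega) _ _)
      · have := hgi i (by omega) i' (by omega) j j' h
        omega
    · rintro (_ | i) hi j
      · simp only [hg0]
        fin_cases j
        · exact hr.1
        · exact hs.1
      · exact hge i (by omega) j

lemma hasCopy_zycleMinus {E : Finset (Finset V)} (ℓ : ℕ) (hℓ₀ : 0 < ℓ) (hℓ : 3 ≤ ℓ)
    (g : ℕ → Fin 2 → V)
    (hinj : ∀ i ≤ ℓ - 3, ∀ i' ≤ ℓ - 3, ∀ j j', g i j = g i' j' → i = i' ∧ j = j')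
    (hedge : ∀ i < ℓ - 3, ∀ j, g (i + 1) j ∈ conbr E (g i 0) (g i 1))
    {a b u w : V} (hab : a ≠ b) (hau : a ≠ u) (haw : a ≠ w) (hbu : b ≠ u) (hbw : b ≠ w)
    (huw : u ≠ w) (hga : ∀ i ≤ ℓ - 3, ∀ j, g i j ≠ a) (hgb : ∀ i ≤ ℓ - 3, ∀ j, g i j ≠ b)
    (hgu : ∀ i ≤ ℓ - 3, ∀ j, g i j ≠ u) (hgw : ∀ i ≤ ℓ - 3, ∀ j, g i j ≠ w)
    (ha : a ∈ conbr E (g (ℓ - 3) 0) (g (ℓ - 3) 1))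
    (hb : b ∈ conbr E (g (ℓ - 3) 0) (g (ℓ - 3) 1))
    (hu : u ∈ conbr E a b) (hg0 : ∀ j, g 0 j ∈ conbr E w u) :
    HasCopy (zycleMinus ℓ hℓ₀) E := by
  set h : ℕ → Fin 2 → V :=
    fun i => if i = 0 then ![a, b] else if i = 1 then ![w, u] else g (i - 2) with hh
  have h0 : h 0 = ![a, b] := rfl
  have h1 : h 1 = ![w, u] := rfl
  have h2 : ∀ i, h (i + 2) = g i := fun i => rfl
  have hne01 : ∀ j j', ![a, b] j ≠ ![w, u] j' := fun j j' => by
    rcases vecPair_eq_or a b j with e | e <;> rcases vecPair_eq_or w u j' with e' | e' <;>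
      rw [e, e'] <;> assumption
  have hg_ne0 : ∀ i ≤ ℓ - 3, ∀ j j', g i j ≠ ![a, b] j' := fun i hi j j' => by
    rcases vecPair_eq_or a b j' with e | e <;> rw [e]
    exacts [hga i hi j, hgb i hi j]
  have hg_ne1 : ∀ i ≤ ℓ - 3, ∀ j j', g i j ≠ ![w, u] j' := fun i hi j j' => by
    rcases vecPair_eq_or w u j' with e | e <;> rw [e]
    exacts [hgw i hi j, hgu i hi j]
  refine ⟨fun x => h x.1.val x.2, ?_, ?_⟩
  · rintro ⟨⟨i, hi⟩, j⟩ ⟨⟨i', hi'⟩, j'⟩ hij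
    have key : i = i' ∧ j = j' := by
      change h i j = h i' j' at hij
      rcases i with _ | _ | i <;> rcases i' with _ | _ | i' <;>
        simp only [zero_add, h0, h1, h2] at hij
      · exact ⟨rfl, vecPair_injective hab hij⟩
      · exact absurd hij (hne01 j j')
      · exact absurd hij.symm (hg_ne0 i' (by omega) j' j)
      · exact absurd hij.symm (hne01 j' j)
      · exact ⟨rfl, vecPair_injective huw.symm hij⟩
      · exact absurd hij.symm (hg_ne1 i' (by omega) j' j)
      · exact absurd hij (hg_ne0 i (by omega) j j')
      · exact absurd hij (hg_ne1 i (by omega) j j')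
      · have := hinj i (by omega) i' (by omega) j j' hij
        omega
    simp [key.1, key.2]
  · intro e he
    obtain ⟨hne, he⟩ := Finset.mem_erase.1 he
    obtain ⟨⟨⟨i, hi⟩, j⟩, -, rfl⟩ := Finset.mem_image.1 he
    have himg : (insert ((⟨(i + 1) % ℓ, Nat.mod_lt _ hℓ₀⟩ : Fin ℓ), j)
        (Finset.univ.image fun j : Fin 2 => ((⟨i, hi⟩ : Fin ℓ), j))).image
          (fun x => h x.1.val x.2) = {h i 0, h i 1, h ((i + 1) % ℓ) j} := by
      ext x
      simp [Fin.exists_fin_two, eq_comm]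
      tauto
    refine himg ▸ ?_
    rw [← mem_conbr]
    rcases i with _ | _ | i
    · rw [zero_add, Nat.mod_eq_of_lt (by omega : 1 < ℓ), h0, h1]
      have hj : j = 1 := by
        fin_cases j
        · exact absurd rfl hne
        · rfl
      subst hj
      exact hu
    · rw [Nat.mod_eq_of_lt (by omega : 0 + 1 + 1 < ℓ)]
      exact hg0 j
    · rw [h2]
      rcases (by omega : i + 1 + 1 + 1 = ℓ ∨ i + 1 + 1 + 1 < ℓ) with hl | hl
      · rw [hl, Nat.mod_self, h0]
        obtain rfl : i = ℓ - 3 := by omega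
        fin_cases j
        · exact ha
        · exact hb
      · rw [Nat.mod_eq_of_lt hl]
        exact hedge i (by omega) j

/-- Some vertex `w` is joined by edges through `u` to a proportion of the vertices of `M`. -/
lemma exists_conbr_inter_large {E : Finset (Finset V)} {ε : ℝ}
    (hd : ∀ x y : V, x ≠ y → ε * Fintype.card V ≤ (conbr E x y).card)
    (u : V) (M : Finset V) (huM : u ∉ M) :
    ∃ w, ε * M.card ≤ ((M.filter fun p => p ∈ conbr E w u).card : ℝ) := by
  by_contra! hcon
  have hcount : ∑ w : V, (M.filter fun p => p ∈ conbr E w u).card =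
      ∑ p ∈ M, (conbr E u p).card := by
    have := Finset.sum_card_bipartiteAbove_eq_sum_card_bipartiteBelow
      (s := (Finset.univ : Finset V)) (t := M) (fun w p => p ∈ conbr E w u)
    simp only [Finset.bipartiteAbove, Finset.bipartiteBelow] at this
    rw [this]
    refine Finset.sum_congr rfl fun p _ => congrArg Finset.card ?_
    ext w
    simp only [Finset.mem_filter, Finset.mem_univ, true_and]
    exact ⟨conbr_rotate, fun h => conbr_rotate (conbr_rotate h)⟩
  have hlt : ∑ w : V, ((M.filter fun p => p ∈ conbr E w u).card : ℝ) <
      ∑ _w : V, ε * M.card :=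
    Finset.sum_lt_sum_of_nonempty ⟨u, Finset.mem_univ u⟩ fun w _ => hcon w
  have hge : ∑ _p ∈ M, ε * Fintype.card V ≤ ∑ p ∈ M, ((conbr E u p).card : ℝ) :=
    Finset.sum_le_sum fun p hp => hd u p fun h => huM (h ▸ hp)
  have hcount' : ∑ w : V, ((M.filter fun p => p ∈ conbr E w u).card : ℝ) =
      ∑ p ∈ M, ((conbr E u p).card : ℝ) := mod_cast hcount
  simp only [Finset.sum_const, nsmul_eq_mul, Finset.card_univ] at hlt hge
  linarith

/-- Some vertex has a link containing a proportion of the ordered pairs of `A`. -/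
lemma exists_dense_link [Nonempty V] {E : Finset (Finset V)} {ε : ℝ}
    (hd : ∀ x y : V, x ≠ y → ε * Fintype.card V ≤ (conbr E x y).card) (A : Finset V) :
    ∃ u, ε * (A.card * (A.card - 1)) ≤
      (((A ×ˢ A).filter fun x => u ∈ conbr E x.1 x.2).card : ℝ) := by
  by_contra! hcon
  have hcount : ∑ u : V, ((A ×ˢ A).filter fun x => u ∈ conbr E x.1 x.2).card =
      ∑ x ∈ A ×ˢ A, (conbr E x.1 x.2).card := by
    have := Finset.sum_card_bipartiteAbove_eq_sum_card_bipartiteBelow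
      (s := (Finset.univ : Finset V)) (t := A ×ˢ A) (fun u x => u ∈ conbr E x.1 x.2)
    simp only [Finset.bipartiteAbove, Finset.bipartiteBelow, Finset.filter_univ_mem] at this
    exact this
  have hlt : ∑ u : V, (((A ×ˢ A).filter fun x => u ∈ conbr E x.1 x.2).card : ℝ) <
      ∑ _u : V, ε * (A.card * (A.card - 1)) :=
    Finset.sum_lt_sum_of_nonempty Finset.univ_nonempty fun u _ => hcon u
  have hge : ∑ _x ∈ A.offDiag, ε * Fintype.card V ≤
      ∑ x ∈ A.offDiag, ((conbr E x.1 x.2).card : ℝ) :=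
    Finset.sum_le_sum fun x hx => hd x.1 x.2 (Finset.mem_offDiag.1 hx).2.2
  have hsub : ∑ x ∈ A.offDiag, ((conbr E x.1 x.2).card : ℝ) ≤
      ∑ x ∈ A ×ˢ A, ((conbr E x.1 x.2).card : ℝ) := by
    refine Finset.sum_le_sum_of_subset_of_nonneg (fun x hx => ?_) fun _ _ _ => by positivity
    rw [Finset.mem_offDiag] at hx
    exact Finset.mem_product.2 ⟨hx.1, hx.2.1⟩
  have hcount' : ∑ u : V, (((A ×ˢ A).filter fun x => u ∈ conbr E x.1 x.2).card : ℝ) =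
      ∑ x ∈ A ×ˢ A, ((conbr E x.1 x.2).card : ℝ) := mod_cast hcount
  simp only [Finset.sum_const, nsmul_eq_mul, Finset.card_univ, Finset.offDiag_card,
    Nat.cast_sub (Nat.le_mul_self _), Nat.cast_mul] at hlt hge
  linarith

/-- In a hypergraph without a copy of `zycleMinus ℓ`, a set of vertices `M` that lies in the
common neighbourhoods of the pairs of `T` yields a large set `A` of vertices inside which the first
vertices of these pairs have no link edges. -/
lemma exists_link_free_set {E : Finset (Finset V)} (hE : ∀ e ∈ E, e.card = 3) {d : ℕ}
    (hd : ∀ x y : V, x ≠ y → d ≤ (conbr E x y).card)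
    (ℓ : ℕ) (hℓ₀ : 0 < ℓ) (hℓ : 3 ≤ ℓ) (hcopy : ¬ HasCopy (zycleMinus ℓ hℓ₀) E)
    (T : Finset (V × V)) (M : Finset V) (hT : ∀ t ∈ T, ∀ p ∈ M, p ∈ conbr E t.2 t.1)
    (hM : 2 * T.card + 1 < M.card) (hTd : 2 * T.card + 2 * ℓ ≤ d) :
    ∃ x y : V, x ≠ y ∧ ∃ A : Finset V, (conbr E x y).card ≤ A.card + 2 * T.card + 2 * ℓ ∧
      ∀ t ∈ T, ∀ a ∈ A, ∀ b ∈ A, t.1 ∉ conbr E a b := by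
  set X : Finset V := T.image Prod.fst ∪ T.image Prod.snd with hX
  have hXcard : X.card ≤ 2 * T.card := by
    have := Finset.card_union_le (T.image Prod.fst) (T.image Prod.snd)
    have := Finset.card_image_le (s := T) (f := Prod.fst)
    have := Finset.card_image_le (s := T) (f := Prod.snd)
    rw [hX]
    omega
  have h2 : 1 < (M \ X).card := by
    have := Finset.le_card_sdiff X M
    omega
  obtain ⟨p, hp, q, hq, hpq⟩ := Finset.one_lt_card.1 h2
  rw [Finset.mem_sdiff] at hp hq
  obtain ⟨g, hg0, hgX, hgi, hge⟩ :=
    exists_pair_path hd (ℓ - 3) X p q hpq hp.2 hq.2 (by omega)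
  set Y : Finset V := (Finset.range (ℓ - 2) ×ˢ Finset.univ).image fun x : ℕ × Fin 2 => g x.1 x.2
    with hY
  have hYcard : Y.card ≤ 2 * ℓ := by
    refine Finset.card_image_le.trans ?_
    rw [Finset.card_product, Finset.card_range, Finset.card_univ, Fintype.card_fin]
    omega
  have hgY : ∀ i ≤ ℓ - 3, ∀ j, g i j ∈ Y := fun i hi j =>
    Finset.mem_image.2 ⟨(i, j), by simp; omega, rfl⟩
  refine ⟨g (ℓ - 3) 0, g (ℓ - 3) 1, ?_,
    conbr E (g (ℓ - 3) 0) (g (ℓ - 3) 1) \ (X ∪ Y), ?_, ?_⟩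
  · intro h
    simpa using (hgi _ le_rfl _ le_rfl _ _ h).2
  · have := Finset.le_card_sdiff (X ∪ Y) (conbr E (g (ℓ - 3) 0) (g (ℓ - 3) 1))
    have := Finset.card_union_le X Y
    omega
  · rintro ⟨u, w⟩ ht a ha b hb hu
    rw [Finset.mem_sdiff, Finset.mem_union, not_or] at ha hb
    have huX : u ∈ X := Finset.mem_union_left _ (Finset.mem_image_of_mem Prod.fst ht)
    have hwX : w ∈ X := Finset.mem_union_right _ (Finset.mem_image_of_mem Prod.snd ht)
    have hab := ne_of_mem_conbr hE hu
    have hwu := ne_of_mem_conbr hE (hT _ ht p hp.1)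
    refine hcopy (hasCopy_zycleMinus ℓ hℓ₀ hℓ g hgi hge (a := a) (b := b) (u := u) (w := w)
      hab.1 hab.2.1.symm ?_ hab.2.2.symm ?_ hwu.1.symm ?_ ?_ ?_ ?_ ha.1 hb.1 hu ?_)
    · exact fun h => ha.2.1 (h ▸ hwX)
    · exact fun h => hb.2.1 (h ▸ hwX)
    · exact fun i hi j h => ha.2.2 (h ▸ hgY i hi j)
    · exact fun i hi j h => hb.2.2 (h ▸ hgY i hi j)
    · exact fun i hi j h => hgX i hi j (h ▸ huX)
    · exact fun i hi j h => hgX i hi j (h ▸ hwX)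
    · intro j
      rw [hg0]
      rcases vecPair_eq_or p q j with e | e <;> rw [e]
      exacts [hT _ ht p hp.1, hT _ ht q hq.1]

/-- In a hypergraph of large codegree without a copy of `zycleMinus ℓ`, one finds successively
vertices whose links contain disjoint dense sets of pairs. -/
lemma exists_disjoint_links [Nonempty V] {E : Finset (Finset V)} {ε : ℝ} (hε : 0 < ε)
    (hε1 : ε ≤ 1) (hE : ∀ e ∈ E, e.card = 3)
    (hd : ∀ x y : V, x ≠ y → ε * Fintype.card V ≤ (conbr E x y).card)
    (ℓ : ℕ) (hℓ₀ : 0 < ℓ) (hℓ : 3 ≤ ℓ) (hcopy : ¬ HasCopy (zycleMinus ℓ hℓ₀) E) (I : ℕ)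
    (hn : (4 * I + 4 * ℓ + 10 : ℝ) ≤ ε ^ (I + 1) * Fintype.card V) :
    ∀ i ≤ I, ∃ (T : Finset (V × V)) (M : Finset V) (F : Finset (V × V)),
      T.card ≤ i ∧ ε ^ i * Fintype.card V - i ≤ M.card ∧
      (∀ t ∈ T, ∀ p ∈ M, p ∈ conbr E t.2 t.1) ∧
      i * (ε ^ 3 / 4 * Fintype.card V ^ 2) ≤ (F.card : ℝ) ∧
      ∀ x ∈ F, ∃ t ∈ T, t.1 ∈ conbr E x.1 x.2 := by
  set N : ℝ := (Fintype.card V : ℝ) with hN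
  have hN0 : 0 ≤ N := by positivity
  have hpow : ∀ i ≤ I + 1, (4 * I + 4 * ℓ + 10 : ℝ) ≤ ε ^ i * N := fun i hi =>
    hn.trans (mul_le_mul_of_nonneg_right (pow_le_pow_of_le_one hε.le hε1 hi) hN0)
  have hεN : (4 * I + 4 * ℓ + 10 : ℝ) ≤ ε * N := by simpa using hpow 1 (by omega)
  have hd' : ∀ x y : V, x ≠ y → 4 * I + 4 * ℓ + 10 ≤ (conbr E x y).card := fun x y hxy => by
    have := hεN.trans (hd x y hxy)
    exact_mod_cast this
  intro i
  induction i with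
  | zero =>
    intro _
    exact ⟨∅, Finset.univ, ∅, by simp, by simp [hN], by simp, by simp, by simp⟩
  | succ i ih =>
    intro hi
    obtain ⟨T, M, F, hTc, hMc, hTM, hFc, hFT⟩ := ih (by omega)
    have hiI : (i : ℝ) + 1 ≤ I := mod_cast hi
    have hℓ' : (3 : ℝ) ≤ ℓ := mod_cast hℓ
    have hTc' : (T.card : ℝ) ≤ i := mod_cast hTc
    have hMlarge : 2 * T.card + 1 < M.card := by
      have := hpow i (by omega)
      have h : (2 * T.card + 1 : ℝ) < M.card := by linarith
      exact_mod_cast h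
    obtain ⟨x, y, hxy, A, hAc, hA⟩ :=
      exists_link_free_set hE hd' ℓ hℓ₀ hℓ hcopy T M hTM hMlarge (by omega)
    have hAc' : ((conbr E x y).card : ℝ) ≤ A.card + 2 * T.card + 2 * ℓ := mod_cast hAc
    have hAlarge : ε * N / 2 ≤ (A.card : ℝ) - 1 := by
      have := hd x y hxy
      linarith
    obtain ⟨u, hu⟩ := exists_dense_link hd A
    obtain ⟨w, hw⟩ := exists_conbr_inter_large hd u (M.erase u) (Finset.notMem_erase u M)
    set L := (A ×ˢ A).filter fun x => u ∈ conbr E x.1 x.2 with hL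
    have hdisj : Disjoint F L := by
      rw [Finset.disjoint_left]
      intro z hzF hzL
      obtain ⟨t, ht, htz⟩ := hFT z hzF
      have hz := Finset.mem_product.1 (Finset.mem_filter.1 hzL).1
      exact hA t ht _ hz.1 _ hz.2 htz
    refine ⟨insert (u, w) T, (M.erase u).filter fun p => p ∈ conbr E w u, F ∪ L, ?_, ?_, ?_, ?_, ?_⟩
    · exact (Finset.card_insert_le _ _).trans (by omega)
    · have h1 : (M.card : ℝ) ≤ (M.erase u).card + 1 := by
        have := Finset.pred_card_le_card_erase (s := M) (a := u)
        have h : M.card ≤ (M.erase u).card + 1 := by omega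
        exact_mod_cast h
      have h2 : ε * (ε ^ i * N - i - 1) ≤ ε * (M.erase u).card :=
        mul_le_mul_of_nonneg_left (by linarith) hε.le
      have h3 : ε * ((i : ℝ) + 1) ≤ 1 * ((i : ℝ) + 1) :=
        mul_le_mul_of_nonneg_right hε1 (by positivity)
      push_cast
      rw [pow_succ]
      linarith
    · intro t ht p hp
      have hp' := Finset.mem_filter.1 hp
      rcases Finset.mem_insert.1 ht with rfl | ht
      · exact hp'.2
      · exact hTM t ht p (Finset.mem_of_mem_erase hp'.1)
    · rw [Finset.card_union_of_disjoint hdisj]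
      have h1 : ε * N / 2 * (ε * N / 2) ≤ A.card * ((A.card : ℝ) - 1) :=
        mul_le_mul (by linarith) hAlarge (by positivity) (by positivity)
      have h2 := mul_le_mul_of_nonneg_left h1 hε.le
      push_cast
      linarith
    · intro z hz
      rcases Finset.mem_union.1 hz with hz | hz
      · obtain ⟨t, ht, htz⟩ := hFT z hz
        exact ⟨t, Finset.mem_insert_of_mem ht, htz⟩
      · exact ⟨(u, w), Finset.mem_insert_self _ _, (Finset.mem_filter.1 hz).2⟩

end Codegree

/-- Large 3-uniform hypergraphs of positive codegree density contain `zycleMinus ℓ`. -/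
lemma exists_hasCopy_zycleMinus (ℓ : ℕ) (hℓ₀ : 0 < ℓ) (hℓ : 3 ≤ ℓ) (ε : ℝ) (hε : 0 < ε) :
    ∃ n₀ : ℕ, ∀ n ≥ n₀, ∀ E : Finset (Finset (Fin n)), (∀ e ∈ E, e.card = 3) →
      (∀ s : Finset (Fin n), s.card = 2 → ε * n ≤ (hdeg E s : ℝ)) →
      HasCopy (zycleMinus ℓ hℓ₀) E := by
  wlog hε1 : ε ≤ 1 generalizing ε
  · obtain ⟨n₀, h⟩ := this 1 one_pos le_rfl
    refine ⟨n₀, fun n hn E hE hdeg => h n hn E hE fun s hs => le_trans ?_ (hdeg s hs)⟩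
    exact mul_le_mul_of_nonneg_right (not_le.1 hε1).le (by positivity)
  obtain ⟨I, hI⟩ := exists_nat_gt (4 / ε ^ 3)
  obtain ⟨n₀, hn₀⟩ := exists_nat_ge ((4 * I + 4 * ℓ + 10 : ℝ) / ε ^ (I + 1))
  refine ⟨n₀ + 1, fun n hn E hE hdeg => ?_⟩
  by_contra hcopy
  have hn0 : 0 < n := by omega
  have : Nonempty (Fin n) := ⟨⟨0, hn0⟩⟩
  have hd : ∀ x y : Fin n, x ≠ y → ε * Fintype.card (Fin n) ≤ (conbr E x y).card := by
    intro x y hxy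
    rw [Fintype.card_fin]
    exact (hdeg {x, y} (Finset.card_pair hxy)).trans (mod_cast hdeg_pair_le hE hxy)
  have hlarge : (4 * I + 4 * ℓ + 10 : ℝ) ≤ ε ^ (I + 1) * Fintype.card (Fin n) := by
    rw [Fintype.card_fin, ← div_le_iff₀' (by positivity)]
    exact hn₀.trans (Nat.cast_le.2 (by omega : n₀ ≤ n))
  obtain ⟨-, -, F, -, -, -, hF, -⟩ :=
    exists_disjoint_links hε hε1 hE hd ℓ hℓ₀ hℓ hcopy I hlarge I le_rfl
  have hFle : (F.card : ℝ) ≤ (n : ℝ) ^ 2 := by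
    have := F.card_le_univ
    rw [Fintype.card_prod, Fintype.card_fin] at this
    rw [sq]
    exact_mod_cast this
  rw [Fintype.card_fin] at hF
  have hI' : 1 < I * (ε ^ 3 / 4) := by
    rw [div_lt_iff₀ (by positivity)] at hI
    linarith
  have hnsq : (0 : ℝ) < (n : ℝ) ^ 2 := by positivity
  nlinarith [mul_lt_mul_of_pos_right hI' hnsq]

/-- The codegree Turán density of `F` vanishes if every positive codegree density forces a copy of
`F` in large hypergraphs. -/
lemma codegTuranDensity_eq_zero {α : Type*} {k : ℕ} {F : Finset (Finset α)}
    (h : ∀ ε : ℝ, 0 < ε → ∃ n₀ : ℕ, ∀ n ≥ n₀, ∀ E : Finset (Finset (Fin n)),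
      (∀ e ∈ E, e.card = k) →
      (∀ s : Finset (Fin n), s.card = k - 1 → ε * n ≤ (hdeg E s : ℝ)) → HasCopy F E) :
    codegTuranDensity k F = 0 := by
  refine Filter.Tendsto.limsup_eq (Metric.tendsto_atTop.2 fun ε hε => ?_)
  obtain ⟨n₀, hn₀⟩ := h (ε / 2) (by positivity)
  refine ⟨n₀ + 1, fun n hn => ?_⟩
  have hnpos : (0 : ℝ) < n := mod_cast (by omega : 0 < n)
  have hle : exco k n F ≤ ⌊ε / 2 * n⌋₊ := by
    refine csSup_le' fun d hd => ?_
    obtain ⟨E, hE, hcopy, hdE⟩ := hd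
    refine Nat.le_floor (le_of_not_gt fun hlt => hcopy ?_)
    exact hn₀ n (by omega) E hE fun s hs => hlt.le.trans (mod_cast hdE s hs)
  have hle' : (exco k n F : ℝ) ≤ ε / 2 * n :=
    (Nat.cast_le.2 hle).trans (Nat.floor_le (by positivity))
  rw [Real.dist_0_eq_abs, abs_of_nonneg (by positivity), div_lt_iff₀ hnpos]
  nlinarith [mul_pos hε hnpos]

/-- Let `ℓ ≥ 3` be an integer. Then `γ(Z_ℓ^{(3)−}) = 0`; equivalently, for every
`ε > 0` there exists `n₀` such that every 3-uniform hypergraph `H` on `n ≥ n₀` vertices with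
minimum codegree `δ(H) ≥ εn` contains a copy of `Z_ℓ^{(3)−}`. -/
theorem statement3 (ℓ : ℕ) (hℓ : 3 ≤ ℓ) :
    codegTuranDensity 3 (zycleMinus ℓ (by omega)) = 0 ∧
    ∀ ε : ℝ, 0 < ε → ∃ n₀ : ℕ, ∀ n ≥ n₀, ∀ E : Finset (Finset (Fin n)),
      (∀ e ∈ E, e.card = 3) →
      (∀ s : Finset (Fin n), s.card = 2 → ε * n ≤ (hdeg E s : ℝ)) →
      HasCopy (zycleMinus ℓ (by omega)) E := by
  have h := exists_hasCopy_zycleMinus ℓ (by omega) hℓ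
  exact ⟨codegTuranDensity_eq_zero h, h⟩
end

section
/- For integers k ≥ 3, r ≥ 2 and c ≥ 1, the c-blow-up Z_r^{(k)}(c) of the k-uniform zycle Z_r^{(k)} contains a copy of Z_{cr}^{(k)}. -/
open Finset

open scoped Classical

/-- The `c`-blow-up of a hypergraph `F` on vertex type `α`: vertices are `α × Fin c`, and a set
`S` is an edge iff its projection to `α` is an edge of `F` and `S` picks exactly one vertex from
each class over that edge. -/
noncomputable def blowup {α : Type*} [DecidableEq α] [Fintype α]
    (F : Finset (Finset α)) (c : ℕ) : Finset (Finset (α × Fin c)) :=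
  Finset.univ.filter fun S : Finset (α × Fin c) =>
    S.image Prod.fst ∈ F ∧ S.card = (S.image Prod.fst).card

/-- For integers `k ≥ 3`, `r ≥ 2` and `c ≥ 1`, the `c`-blow-up `Z_r^{(k)}(c)` of the
`k`-uniform zycle `Z_r^{(k)}` contains a copy of `Z_{cr}^{(k)}`. -/
theorem statement5 (k r c : ℕ) (hk : 3 ≤ k) (hr : 2 ≤ r) (hc : 1 ≤ c) :
    HasCopy (zycle k (c * r)) (blowup (zycle k r) c) := by
  have hr0 : 0 < r := by omega
  let π : Fin (c * r) × Fin (k - 1) → Fin r × Fin (k - 1) :=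
    fun p => (⟨p.1.val % r, Nat.mod_lt _ hr0⟩, p.2)
  let f : Fin (c * r) × Fin (k - 1) → (Fin r × Fin (k - 1)) × Fin c :=
    fun p => (π p, ⟨p.1.val / r, Nat.div_lt_of_lt_mul (p.1.isLt.trans_eq (mul_comm c r))⟩)
  have hf : Function.Injective f := by
    rintro ⟨⟨a, ha⟩, j⟩ ⟨⟨b, hb⟩, l⟩ h
    simp only [f, π, Prod.mk.injEq, Fin.mk.injEq] at h ⊢
    obtain ⟨⟨hmod, hj⟩, hdiv⟩ := h
    refine ⟨?_, hj⟩
    rw [← Nat.div_add_mod a r, ← Nat.div_add_mod b r, hmod, hdiv]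
  refine ⟨f, hf, fun e he => ?_⟩
  have hfst : Prod.fst ∘ f = π := rfl
  simp only [zycle, mem_image, mem_univ, true_and] at he
  obtain ⟨⟨i, j⟩, rfl⟩ := he
  have hsucc : (i.val + 1) % (c * r) % r = (i.val % r + 1) % r := by
    rw [Nat.mod_mod_of_dvd _ (Dvd.intro_left c rfl), Nat.mod_add_mod]
  have hne : i.val % r ≠ (i.val % r + 1) % r := by
    have hlt := Nat.mod_lt i.val hr0
    rcases (Nat.succ_le_of_lt hlt).lt_or_eq with h | h
    · rw [Nat.mod_eq_of_lt h]; omega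
    · rw [show i.val % r + 1 = r from h, Nat.mod_self]; omega
  simp only [blowup, mem_filter, mem_univ, true_and]
  rw [image_image, hfst]
  constructor
  · simp only [zycle, mem_image, mem_univ, true_and]
    refine ⟨π (i, j), ?_⟩
    rw [image_insert, image_image]
    simp only [π, hsucc]
    rfl
  · rw [card_image_of_injective _ hf, card_image_of_injOn]
    intro a ha b hb hab
    simp only [coe_insert, coe_image, coe_univ, Set.image_univ, Set.mem_insert_iff,
      Set.mem_range] at ha hb
    rcases ha with rfl | ⟨a, rfl⟩ <;> rcases hb with rfl | ⟨b, rfl⟩ <;>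
      simp only [π, Prod.mk.injEq, Fin.mk.injEq, hsucc] at hab
    · rfl
    · exact absurd hab.1.symm hne
    · exact absurd hab.1 hne
    · rw [hab.2]
end

section
/- Let t, k, c ∈ ℕ with k ≥ 2, let 𝓕 = {F_1, …, F_t} be a finite family of k-uniform hypergraphs with |V(F_i)| = f_i, and let α ∈ [0,1] be such that for every δ > 0 there exists m_0 with the property that every k-uniform hypergraph on m ≥ m_0 vertices with minimum codegree at least (α+δ)m contains a copy of some F_i (i.e., α ≥ γ(𝓕)). Then for every ε > 0 there exists ζ > 0 such that for all sufficiently large n the following holds: every k-uniform hypergraph H on n vertices with δ(H) ≥ (α+ε)n contains, for some i ∈ [t], at least ζ·C(n, f_i) sets S of f_i vertices such that H[S] contains a copy of F_i; consequently, H contains a copy of the c-blow-up F_i(c). -/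
open Finset

open scoped Classical

/-- Chernoff's lower-tail bound for the number of coordinates of a uniformly random function
that lie in a set of density at least `p`, in counting form. -/
theorem card_few_hits_le {n m : ℕ} (hn : 0 < n) (N : Finset (Fin n)) {p η : ℝ} (hη : 0 < η)
    (hp : 0 ≤ p) (hN : p * n ≤ #N) :
    (#{g : Fin m → Fin n | (#{v | g v ∈ N} : ℝ) ≤ (p - η) * m} : ℝ) ≤
      Real.exp (-(η ^ 2 / 2)) ^ m * n ^ m := by
  have hn' : (0 : ℝ) < n := by exact_mod_cast hn
  have hNn : (#N : ℝ) ≤ n := by exact_mod_cast (card_le_univ N).trans (by simp)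
  have hp1 : p ≤ 1 := by
    by_contra! h
    nlinarith
  have hexp : Real.exp (-η) ≤ 1 - η + η ^ 2 / 2 := by
    have h1 := Real.quadratic_le_exp_of_nonneg hη.le
    have h2 : Real.exp (-η) * Real.exp η = 1 := by rw [← Real.exp_add]; simp
    have h3 := Real.exp_pos (-η)
    have h4 : Real.exp (-η) * (1 + η + η ^ 2 / 2) ≤ 1 :=
      (mul_le_mul_of_nonneg_left h1 h3.le).trans h2.le
    have h5 : (1 : ℝ) ≤ (1 - η + η ^ 2 / 2) * (1 + η + η ^ 2 / 2) := by
      nlinarith [sq_nonneg (η ^ 2)]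
    have h6 : 0 < 1 + η + η ^ 2 / 2 := by positivity
    exact le_of_mul_le_mul_right (h4.trans h5) h6
  let w : Fin n → ℝ := fun u => if u ∈ N then Real.exp (-η) else 1
  have hw : ∀ g : Fin m → Fin n, ∏ v, w (g v) = Real.exp (-η * #{v | g v ∈ N}) := by
    intro g
    simp only [w]
    rw [prod_ite]
    simp [← Real.exp_nat_mul, mul_comm]
  have hsum : ∑ u, w u ≤ n * Real.exp (-(p * (η - η ^ 2 / 2))) := by
    have h1 : ∑ u, w u = n - #N * (1 - Real.exp (-η)) := by
      have h : ∀ u, w u = 1 - (if u ∈ N then (1 - Real.exp (-η)) else 0) := by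
        intro u; simp only [w]; split_ifs <;> ring
      simp_rw [h, sum_sub_distrib]
      simp [mul_sub]
    have h2 : Real.exp (-η) ≤ 1 := by simp [hη.le]
    have h3 : ∑ u, w u ≤ n * (1 - p * (1 - Real.exp (-η))) := by
      rw [h1]; nlinarith
    have h4 := Real.one_sub_le_exp_neg (p * (η - η ^ 2 / 2))
    refine h3.trans (mul_le_mul_of_nonneg_left (le_trans ?_ h4) hn'.le)
    nlinarith
  calc (#{g : Fin m → Fin n | (#{v | g v ∈ N} : ℝ) ≤ (p - η) * m} : ℝ)
      = ∑ g : Fin m → Fin n with (#{v | g v ∈ N} : ℝ) ≤ (p - η) * m, (1 : ℝ) := by simp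
    _ ≤ ∑ g : Fin m → Fin n with (#{v | g v ∈ N} : ℝ) ≤ (p - η) * m,
          Real.exp (η * ((p - η) * m)) * ∏ v, w (g v) := by
        refine sum_le_sum fun g hg => ?_
        rw [mem_filter] at hg
        rw [hw, ← Real.exp_add]
        refine Real.one_le_exp ?_
        nlinarith [hg.2]
    _ ≤ ∑ g : Fin m → Fin n, Real.exp (η * ((p - η) * m)) * ∏ v, w (g v) := by
        refine sum_le_sum_of_subset_of_nonneg (subset_univ _) fun g _ _ => ?_
        rw [hw]; positivity
    _ = Real.exp (η * (p - η)) ^ m * (∑ u, w u) ^ m := by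
        rw [← mul_sum, ← Fintype.sum_pow, ← Real.exp_nat_mul]
        ring_nf
    _ ≤ Real.exp (η * (p - η)) ^ m * (n * Real.exp (-(p * (η - η ^ 2 / 2)))) ^ m := by
        have : 0 ≤ ∑ u, w u := sum_nonneg fun u _ => by
          simp only [w]; split_ifs <;> positivity
        gcongr
    _ = Real.exp (η * (p - η) + -(p * (η - η ^ 2 / 2))) ^ m * n ^ m := by
        rw [Real.exp_add]; ring
    _ ≤ Real.exp (-(η ^ 2 / 2)) ^ m * n ^ m := by
        gcongr
        nlinarith [sq_nonneg η]

theorem card_not_injective_le (n m : ℕ) :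
    (n : ℝ) * #{φ : Fin m → Fin n | ¬ Function.Injective φ} ≤ m ^ 2 * n ^ m := by
  have hpair : ∀ i j : Fin m, i ≠ j → n * #{φ : Fin m → Fin n | φ i = φ j} ≤ n ^ m := by
    intro i j hij
    have h : #((univ : Finset (Fin n)) ×ˢ ({φ | φ i = φ j} : Finset (Fin m → Fin n))) ≤
        #(univ : Finset (Fin m → Fin n)) := by
      refine card_le_card_of_injOn (fun q => Function.update q.2 i q.1) (by simp) ?_
      rintro ⟨x, φ⟩ hφ ⟨y, ψ⟩ hψ h
      simp only [coe_product, coe_filter, Set.mem_prod, Set.mem_ofPred_eq, mem_univ,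
        true_and, coe_univ, Set.mem_univ] at hφ hψ
      have hv : ∀ v, v ≠ i → φ v = ψ v := fun v hv => by
        simpa [hv] using congrFun h v
      refine Prod.ext (by simpa using congrFun h i) (funext fun v => ?_)
      by_cases hvi : v = i
      · subst hvi
        exact hφ.trans ((hv j hij.symm).trans hψ.symm)
      · exact hv v hvi
    simpa using h
  have hsub : ({φ : Fin m → Fin n | ¬ Function.Injective φ} : Finset _) ⊆
      (univ.filter fun q : Fin m × Fin m => q.1 ≠ q.2).biUnion
        fun q => ({φ | φ q.1 = φ q.2} : Finset (Fin m → Fin n)) := by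
    intro φ hφ
    simp only [mem_filter, mem_univ, true_and, Function.Injective, not_forall] at hφ
    obtain ⟨a, b, hab, hne⟩ := hφ
    simp only [mem_biUnion, mem_filter, mem_univ, true_and]
    exact ⟨(a, b), hne, hab⟩
  have : n * #{φ : Fin m → Fin n | ¬ Function.Injective φ} ≤ m ^ 2 * n ^ m := by
    calc n * #{φ : Fin m → Fin n | ¬ Function.Injective φ}
        ≤ n * ∑ q : Fin m × Fin m with q.1 ≠ q.2, #{φ : Fin m → Fin n | φ q.1 = φ q.2} :=
          Nat.mul_le_mul_left _ ((card_le_card hsub).trans card_biUnion_le)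
      _ = ∑ q : Fin m × Fin m with q.1 ≠ q.2, n * #{φ : Fin m → Fin n | φ q.1 = φ q.2} :=
          mul_sum ..
      _ ≤ ∑ q : Fin m × Fin m with q.1 ≠ q.2, n ^ m :=
          sum_le_sum fun q hq => hpair _ _ (mem_filter.1 hq).2
      _ ≤ ∑ q : Fin m × Fin m, n ^ m := sum_le_sum_of_subset (subset_univ _)
      _ = m ^ 2 * n ^ m := by simp [sq]
  exact_mod_cast this

/-- If `ψ` is injective, then a uniformly random function stays uniformly random after
precomposition with `ψ`. -/
theorem card_comp_mem_mul_le {n m r : ℕ} {ψ : Fin r → Fin m} (hψ : Function.Injective ψ)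
    (X : Finset (Fin r → Fin n)) :
    #{φ : Fin m → Fin n | φ ∘ ψ ∈ X} * n ^ r ≤ #X * n ^ m := by
  have h : #(({φ | φ ∘ ψ ∈ X} : Finset (Fin m → Fin n)) ×ˢ (univ : Finset (Fin r → Fin n))) ≤
      #(X ×ˢ (univ : Finset (Fin m → Fin n))) := by
    refine card_le_card_of_injOn
      (fun q => (q.1 ∘ ψ, Function.extend ψ q.2 q.1)) (fun q hq => by simpa using hq) ?_
    rintro ⟨φ, g⟩ - ⟨φ', g'⟩ - h
    simp only [Prod.mk.injEq] at h
    obtain ⟨h1, h2⟩ := h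
    refine Prod.ext (funext fun v => ?_) (funext fun u => ?_)
    · by_cases hv : ∃ u, ψ u = v
      · obtain ⟨u, rfl⟩ := hv
        exact congrFun h1 u
      · simpa [Function.extend_apply' _ _ _ hv] using congrFun h2 v
    · simpa [hψ.extend_apply] using congrFun h2 (ψ u)
  simpa using h

/-- Resampling the values outside `s`: a property of pairs `(φ, g)` may be averaged over
`s.piecewise φ g` instead of `φ`. -/
theorem card_mul_le_of_piecewise {n m : ℕ} (s : Finset (Fin m)) (B : Finset (Fin m → Fin n))
    {K : ℝ} (hK : ∀ φ : Fin m → Fin n,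
      (#{g : Fin m → Fin n | s.piecewise φ g ∈ B} : ℝ) ≤ K) (hn : 0 < n) :
    (#B : ℝ) ≤ K := by
  have h : #(B ×ˢ (univ : Finset (Fin m → Fin n))) ≤
      #((univ : Finset (Fin m → Fin n)).sigma
        fun φ => ({g | s.piecewise φ g ∈ B} : Finset (Fin m → Fin n))) := by
    refine card_le_card_of_injOn
      (fun q => ⟨s.piecewise q.1 q.2, s.piecewise q.2 q.1⟩) (fun q hq => ?_) ?_
    · have : s.piecewise (s.piecewise q.1 q.2) (s.piecewise q.2 q.1) = q.1 := by
        ext v; by_cases hv : v ∈ s <;> simp [hv]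
      simp only [coe_sigma, Set.mem_sigma_iff, coe_filter, Set.mem_ofPred_eq, mem_univ, true_and,
        coe_univ, Set.mem_univ, this]
      simpa using hq
    · rintro ⟨φ, g⟩ - ⟨φ', g'⟩ - h
      simp only [Sigma.mk.injEq, heq_eq_eq] at h
      obtain ⟨h1, h2⟩ := h
      refine Prod.ext (funext fun v => ?_) (funext fun v => ?_)
      · by_cases hv : v ∈ s
        · simpa [hv] using congrFun h1 v
        · simpa [hv] using congrFun h2 v
      · by_cases hv : v ∈ s
        · simpa [hv] using congrFun h2 v
        · simpa [hv] using congrFun h1 v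
  rw [card_product, card_sigma] at h
  have hle : (#B : ℝ) * n ^ m ≤ n ^ m * K := by
    calc (#B : ℝ) * n ^ m ≤ ∑ φ : Fin m → Fin n,
          (#{g : Fin m → Fin n | s.piecewise φ g ∈ B} : ℝ) := by
            simpa using (Nat.cast_le (α := ℝ)).2 h
      _ ≤ ∑ φ : Fin m → Fin n, K := sum_le_sum fun φ _ => hK φ
      _ = n ^ m * K := by simp
  have hpos : (0 : ℝ) < n ^ m := by positivity
  rw [mul_comm] at hle
  exact le_of_mul_le_mul_left hle hpos

/-- The partite box theorem of Erdős: a set of positive density in `(Fin n) ^ r` contains a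
product of `r` sets of size `c + 1`, provided that `n` is large. -/
theorem exists_box (c r : ℕ) : ∀ d : ℝ, 0 < d → ∃ n₀ : ℕ, ∀ n ≥ n₀,
    ∀ A : Finset (Fin r → Fin n), d * n ^ r ≤ #A →
      ∃ b : Fin r → Fin (c + 1) → Fin n, (∀ u, Function.Injective (b u)) ∧
        ∀ j : Fin r → Fin (c + 1), (fun u => b u (j u)) ∈ A := by
  induction r with
  | zero =>
    refine fun d hd => ⟨0, fun n _ A hA => ⟨fun u => u.elim0, fun u => u.elim0, fun j => ?_⟩⟩
    have hpos : (0 : ℝ) < #A := by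
      refine lt_of_lt_of_le ?_ hA
      simpa using hd
    obtain ⟨a, ha⟩ := card_pos.1 (Nat.cast_pos.1 hpos)
    convert ha
  | succ r ih =>
    intro d hd
    have hd' : 0 < d ^ (c + 1) / 2 := by positivity
    obtain ⟨n₁, hn₁⟩ := ih _ hd'
    obtain ⟨n₂, hn₂⟩ := exists_nat_gt (((c + 1 : ℕ) : ℝ) ^ 2 / (d ^ (c + 1) / 2))
    refine ⟨max n₁ (max n₂ 1), fun n hn A hA => ?_⟩
    have hnn₁ : n₁ ≤ n := le_trans (le_max_left _ _) hn
    have hnn₂ : n₂ ≤ n := le_trans ((le_max_left _ _).trans (le_max_right _ _)) hn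
    have hn0 : 1 ≤ n := le_trans ((le_max_right _ _).trans (le_max_right _ _)) hn
    have hnR : (0 : ℝ) < n := by exact_mod_cast hn0
    have hbig : ((c + 1 : ℕ) : ℝ) ^ 2 < n * (d ^ (c + 1) / 2) := by
      rw [div_lt_iff₀ hd'] at hn₂
      have : (n₂ : ℝ) ≤ n := by exact_mod_cast hnn₂
      nlinarith
    let a : (Fin r → Fin n) → Finset (Fin n) := fun y =>
      {x | (Fin.cons x y : Fin (r + 1) → Fin n) ∈ A}
    have hAsum : (#A : ℝ) = ∑ y, (#(a y) : ℝ) := by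
      have : #A = #((univ : Finset (Fin r → Fin n)).sigma a) := by
        refine card_bij' (fun g _ => ⟨Fin.tail g, g 0⟩) (fun q _ => Fin.cons q.2 q.1)
          (fun g hg => by simpa [a] using hg) (fun q hq => by simpa [a] using hq)
          (fun g _ => by simp) (fun q _ => by simp)
      rw [this, card_sigma]
      push_cast
      rfl
    have hpow : d ^ (c + 1) * n ^ (c + 1) * n ^ r ≤ ∑ y, (#(a y) : ℝ) ^ (c + 1) := by
      have h := pow_sum_div_card_le_sum_pow (s := univ) (f := fun y => (#(a y) : ℝ))
        (fun _ _ => by positivity) c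
      refine le_trans ?_ h
      rw [← hAsum]
      have hcard : ((#(univ : Finset (Fin r → Fin n)) : ℕ) : ℝ) = n ^ r := by simp
      rw [hcard, le_div_iff₀ (by positivity)]
      calc d ^ (c + 1) * n ^ (c + 1) * n ^ r * (n ^ r) ^ c
          = (d * n ^ (r + 1)) ^ (c + 1) := by ring
        _ ≤ (#A : ℝ) ^ (c + 1) := by gcongr
    let I : Finset (Fin (c + 1) → Fin n) := {τ | Function.Injective τ}
    let Y : (Fin (c + 1) → Fin n) → Finset (Fin r → Fin n) := fun τ => {y | ∀ j, τ j ∈ a y}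
    have hsplit : ∀ y, (#(a y) : ℝ) ^ (c + 1) ≤ #{τ ∈ I | ∀ j, τ j ∈ a y} +
        #{τ : Fin (c + 1) → Fin n | ¬ Function.Injective τ} := by
      intro y
      have h1 : #(a y) ^ (c + 1) = #(Fintype.piFinset fun _ : Fin (c + 1) => a y) := by simp
      have h2 : (Fintype.piFinset fun _ : Fin (c + 1) => a y) ⊆ {τ ∈ I | ∀ j, τ j ∈ a y} ∪
          univ.filter fun τ : Fin (c + 1) → Fin n => ¬ Function.Injective τ := by
        intro τ hτ
        rw [Fintype.mem_piFinset] at hτ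
        by_cases hi : Function.Injective τ <;> simp [I, hi, hτ]
      have h3 := (card_le_card h2).trans (card_union_le _ _)
      rw [← h1] at h3
      exact_mod_cast h3
    have hnoninj : (#{τ : Fin (c + 1) → Fin n | ¬ Function.Injective τ} : ℝ) <
        d ^ (c + 1) / 2 * n ^ (c + 1) := by
      have h := card_not_injective_le n (c + 1)
      have h2 : ((c + 1 : ℕ) : ℝ) ^ 2 * n ^ (c + 1) < n * (d ^ (c + 1) / 2) * n ^ (c + 1) := by
        gcongr
      refine lt_of_mul_lt_mul_left (lt_of_le_of_lt h ?_) hnR.le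
      linarith
    have hswap : ∑ y, (#{τ ∈ I | ∀ j, τ j ∈ a y} : ℝ) = ∑ τ ∈ I, (#(Y τ) : ℝ) := by
      have := sum_card_bipartiteAbove_eq_sum_card_bipartiteBelow
        (fun (y : Fin r → Fin n) (τ : Fin (c + 1) → Fin n) => ∀ j, τ j ∈ a y)
        (s := univ) (t := I)
      exact_mod_cast this
    obtain ⟨τ, hτ, hYτ⟩ : ∃ τ ∈ I, d ^ (c + 1) / 2 * n ^ r ≤ #(Y τ) := by
      by_contra! hcon
      have hup : ∑ τ ∈ I, (#(Y τ) : ℝ) ≤ n ^ (c + 1) * (d ^ (c + 1) / 2 * n ^ r) := by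
        calc ∑ τ ∈ I, (#(Y τ) : ℝ) ≤ ∑ τ ∈ I, d ^ (c + 1) / 2 * (n : ℝ) ^ r :=
              sum_le_sum fun τ hτ => (hcon τ hτ).le
          _ ≤ ∑ τ : Fin (c + 1) → Fin n, d ^ (c + 1) / 2 * (n : ℝ) ^ r :=
              sum_le_sum_of_subset_of_nonneg (subset_univ _) fun _ _ _ => by positivity
          _ = n ^ (c + 1) * (d ^ (c + 1) / 2 * n ^ r) := by simp
      have hlow := hpow.trans (sum_le_sum fun y _ => hsplit y)
      rw [sum_add_distrib, hswap] at hlow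
      simp only [sum_const, card_univ, Fintype.card_fun, Fintype.card_fin, nsmul_eq_mul,
        Nat.cast_pow] at hlow
      have hnr : (0 : ℝ) < n ^ r := by positivity
      nlinarith [mul_lt_mul_of_pos_left hnoninj hnr]
    obtain ⟨b, hb, hbox⟩ := hn₁ n hnn₁ (Y τ) hYτ
    refine ⟨Fin.cons τ b, fun u => ?_, fun j => ?_⟩
    · refine Fin.cases ?_ (fun u => ?_) u
      · simpa [I] using hτ
      · simpa using hb u
    · have h := hbox (fun u => j u.succ)
      simp only [Y, a, mem_filter, mem_univ, true_and] at h
      convert h (j 0) using 1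
      funext u
      refine Fin.cases ?_ (fun u => ?_) u <;> simp

/-- The `k`-uniform hypergraph of the `k`-sets that `φ` maps onto edges of `E`. -/
noncomputable def pullback {n m : ℕ} (k : ℕ) (φ : Fin m → Fin n) (E : Finset (Finset (Fin n))) :
    Finset (Finset (Fin m)) :=
  {e | #e = k ∧ e.image φ ∈ E}

/-- For a fixed `(k-1)`-set `s`, few injective maps `φ` give `s` a small degree in the pullback
along `φ` of a hypergraph of large minimum codegree. -/
theorem card_hdeg_pullback_lt_le {k n m : ℕ} (hk : 1 ≤ k) (hn : 0 < n)
    {E : Finset (Finset (Fin n))} (hE : ∀ e ∈ E, #e = k) {p η β : ℝ} (hη : 0 < η) (hp : 0 ≤ p)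
    (hdegE : ∀ s : Finset (Fin n), #s = k - 1 → p * n ≤ (hdeg E s : ℝ))
    (hβ : β * m + k ≤ (p - η) * m) {s : Finset (Fin m)} (hs : #s = k - 1) :
    (#{φ : Fin m → Fin n | Function.Injective φ ∧ (hdeg (pullback k φ E) s : ℝ) < β * m} : ℝ) ≤
      Real.exp (-(η ^ 2 / 2)) ^ m * n ^ m := by
  refine card_mul_le_of_piecewise s _ (fun φ => ?_) hn
  have hagree : ∀ g : Fin m → Fin n, s.image (s.piecewise φ g) = s.image φ := fun g =>
    image_congr fun v hv => by simp [mem_coe.1 hv]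
  by_cases hinj : #(s.image φ) = k - 1
  · let N : Finset (Fin n) := {w | w ∉ s.image φ ∧ insert w (s.image φ) ∈ E}
    have hN : p * n ≤ #N := by
      refine (hdegE _ hinj).trans ?_
      have hsub : (E.filter fun e => s.image φ ⊆ e) ⊆ N.image fun w => insert w (s.image φ) := by
        intro e he
        rw [mem_filter] at he
        have hcard : #(e \ s.image φ) = 1 := by
          rw [card_sdiff_of_subset he.2, hE e he.1, hinj]
          omega
        obtain ⟨w, hw⟩ := card_eq_one.1 hcard
        have hwe : w ∈ e \ s.image φ := by simp [hw]
        have hins : insert w (s.image φ) = e := by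
          rw [insert_eq, ← hw, sdiff_union_of_subset he.2]
        exact mem_image.2 ⟨w, by simpa only [N, mem_filter, mem_univ, true_and, hins] using
          ⟨(mem_sdiff.1 hwe).2, he.1⟩, hins⟩
      exact_mod_cast (card_le_card hsub).trans card_image_le
    refine le_trans ?_ (card_few_hits_le hn N hη hp hN)
    refine Nat.cast_le.2 (card_le_card fun g hg => ?_)
    simp only [mem_filter, mem_univ, true_and] at hg ⊢
    obtain ⟨-, hlt⟩ := hg
    have hhits : #(({v | g v ∈ N} : Finset (Fin m)) \ s) ≤
        hdeg (pullback k (s.piecewise φ g) E) s := by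
      refine card_le_card_of_injOn (fun v => insert v s) (fun v hv => ?_) ?_
      · simp only [N, mem_coe, mem_sdiff, mem_filter, mem_univ, true_and] at hv
        simp only [coe_filter, pullback, mem_filter, mem_univ, true_and, Set.mem_ofPred_eq]
        refine ⟨⟨by rw [card_insert_of_notMem hv.2, hs]; omega, ?_⟩, subset_insert _ _⟩
        rw [image_insert, hagree]
        simpa [hv.2] using hv.1.2
      · intro v hv w hw h
        simp only [coe_sdiff, Set.mem_sdiff, mem_coe] at hv hw
        exact (insert_inj hv.2).1 h
    have hall : #({v | g v ∈ N} : Finset (Fin m)) ≤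
        hdeg (pullback k (s.piecewise φ g) E) s + k := by
      have := card_le_card_sdiff_add_card (s := ({v | g v ∈ N} : Finset (Fin m))) (t := s)
      omega
    have hall' : (#({v | g v ∈ N} : Finset (Fin m)) : ℝ) ≤
        hdeg (pullback k (s.piecewise φ g) E) s + k := by exact_mod_cast hall
    linarith
  · have : #{g : Fin m → Fin n | s.piecewise φ g ∈ ({φ : Fin m → Fin n | Function.Injective φ ∧
        (hdeg (pullback k φ E) s : ℝ) < β * m} : Finset _)} = 0 := by
      rw [card_eq_zero, filter_eq_empty_iff]
      intro g _ hg
      rw [mem_filter] at hg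
      exact hinj (by rw [← hagree g, card_image_of_injective _ hg.2.1, hs])
    rw [this]
    simp only [Nat.cast_zero]
    positivity

/-- Most maps into a hypergraph of large minimum codegree are injective and pull it back to a
hypergraph of large minimum codegree. -/
theorem half_le_card_good {k n m : ℕ} (hk : 1 ≤ k) (hn : 0 < n)
    {E : Finset (Finset (Fin n))} (hE : ∀ e ∈ E, #e = k) {p η β : ℝ} (hη : 0 < η) (hp : 0 ≤ p)
    (hdegE : ∀ s : Finset (Fin n), #s = k - 1 → p * n ≤ (hdeg E s : ℝ))
    (hβ : β * m + k ≤ (p - η) * m)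
    (hm : (m : ℝ) ^ (k - 1) * Real.exp (-(η ^ 2 / 2)) ^ m ≤ 1 / 4) (hnm : 4 * m ^ 2 ≤ n) :
    (n : ℝ) ^ m / 2 ≤ #{φ : Fin m → Fin n | Function.Injective φ ∧
      ∀ s : Finset (Fin m), #s = k - 1 → β * m ≤ (hdeg (pullback k φ E) s : ℝ)} := by
  have hnR : (0 : ℝ) < n := by exact_mod_cast hn
  have hnoninj : (#{φ : Fin m → Fin n | ¬ Function.Injective φ} : ℝ) ≤ n ^ m / 4 := by
    have h := card_not_injective_le n m
    have h2 : 4 * (m : ℝ) ^ 2 ≤ n := by exact_mod_cast hnm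
    have h3 : 4 * (m : ℝ) ^ 2 * n ^ m ≤ n * n ^ m := by gcongr
    refine le_of_mul_le_mul_left (h.trans ?_) hnR
    linarith
  let B : Finset (Fin m) → Finset (Fin m → Fin n) := fun s =>
    {φ | Function.Injective φ ∧ (hdeg (pullback k φ E) s : ℝ) < β * m}
  have hB : (#((powersetCard (k - 1) univ).biUnion B) : ℝ) ≤ n ^ m / 4 := by
    calc (#((powersetCard (k - 1) univ).biUnion B) : ℝ)
        ≤ ∑ s ∈ powersetCard (k - 1) univ, (#(B s) : ℝ) := by exact_mod_cast card_biUnion_le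
      _ ≤ ∑ s ∈ powersetCard (k - 1) (univ : Finset (Fin m)),
            Real.exp (-(η ^ 2 / 2)) ^ m * (n : ℝ) ^ m :=
          sum_le_sum fun s hs => card_hdeg_pullback_lt_le hk hn hE hη hp hdegE hβ
            (mem_powersetCard.1 hs).2
      _ = (m.choose (k - 1) : ℝ) * (Real.exp (-(η ^ 2 / 2)) ^ m * n ^ m) := by simp
      _ ≤ (m : ℝ) ^ (k - 1) * (Real.exp (-(η ^ 2 / 2)) ^ m * n ^ m) := by
          gcongr
          exact_mod_cast Nat.choose_le_pow m (k - 1)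
      _ = (m : ℝ) ^ (k - 1) * Real.exp (-(η ^ 2 / 2)) ^ m * n ^ m := by ring
      _ ≤ 1 / 4 * n ^ m := by gcongr
      _ = n ^ m / 4 := by ring
  have hcover : (univ : Finset (Fin m → Fin n)) ⊆
      (univ.filter (fun φ => Function.Injective φ ∧ ∀ s : Finset (Fin m), #s = k - 1 →
        β * m ≤ (hdeg (pullback k φ E) s : ℝ)) ∪
          univ.filter fun φ => ¬ Function.Injective φ) ∪
        (powersetCard (k - 1) univ).biUnion B := by
    intro φ _
    by_cases hi : Function.Injective φ
    · by_cases hall : ∀ s : Finset (Fin m), #s = k - 1 →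
        β * m ≤ (hdeg (pullback k φ E) s : ℝ)
      · exact mem_union_left _ (mem_union_left _ (by simpa [hi] using hall))
      · push Not at hall
        obtain ⟨s, hs, hlt⟩ := hall
        refine mem_union_right _ (mem_biUnion.2 ⟨s, by simp [mem_powersetCard, hs], ?_⟩)
        simpa [B, hi] using hlt
    · exact mem_union_left _ (mem_union_right _ (by simp [hi]))
  have h := (card_le_card hcover).trans
    ((card_union_le _ _).trans (Nat.add_le_add_right (card_union_le _ _) _))
  have h' := (Nat.cast_le (α := ℝ)).2 h
  push_cast at h'
  simp only [card_univ, Fintype.card_fun, Fintype.card_fin, Nat.cast_pow] at h'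
  linarith

/-- The injective homomorphisms from a hypergraph `F` to a hypergraph `E`. -/
noncomputable def embeddings {r n : ℕ} (F : Finset (Finset (Fin r)))
    (E : Finset (Finset (Fin n))) : Finset (Fin r → Fin n) :=
  {χ | Function.Injective χ ∧ ∀ e ∈ F, e.image χ ∈ E}

/-- The choice of the sampling size: beyond every bound there is room for the concentration
estimate of `half_le_card_good`. -/
theorem exists_sample_size (k m₀ : ℕ) {η : ℝ} (hη : 0 < η) :
    ∃ m ≥ m₀, (k : ℝ) ≤ η * m ∧ (m : ℝ) ^ (k - 1) * Real.exp (-(η ^ 2 / 2)) ^ m ≤ 1 / 4 := by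
  have hlt : |Real.exp (-(η ^ 2 / 2))| < 1 := by
    rw [abs_of_pos (Real.exp_pos _), Real.exp_lt_one_iff]
    have : 0 < η ^ 2 := by positivity
    linarith
  have h1 := (tendsto_pow_const_mul_const_pow_of_abs_lt_one (k - 1) hlt).eventually_le_const
    (show (0 : ℝ) < 1 / 4 by norm_num)
  have h2 := (tendsto_natCast_atTop_atTop (R := ℝ)).eventually_ge_atTop ((k : ℝ) / η)
  obtain ⟨m, ⟨hm1, hm2⟩, hm3⟩ := ((h1.and h2).and (Filter.eventually_ge_atTop m₀)).exists
  refine ⟨m, hm3, ?_, hm1⟩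
  rwa [div_le_iff₀' hη] at hm2

/-- Supersaturation for embeddings. -/
theorem exists_many_embeddings {t k : ℕ} (hk : 1 ≤ k) (f : Fin t → ℕ)
    (F : (i : Fin t) → Finset (Finset (Fin (f i)))) {α : ℝ} (hα : 0 ≤ α)
    (hγ : ∀ δ : ℝ, 0 < δ → ∃ m₀ : ℕ, ∀ m ≥ m₀, ∀ E : Finset (Finset (Fin m)),
      (∀ e ∈ E, #e = k) →
      (∀ s : Finset (Fin m), #s = k - 1 → (α + δ) * m ≤ (hdeg E s : ℝ)) →
      ∃ i, HasCopy (F i) E) {ε : ℝ} (hε : 0 < ε) :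
    ∃ d : ℝ, 0 < d ∧ ∃ n₀ : ℕ, ∀ n ≥ n₀, ∀ E : Finset (Finset (Fin n)),
      (∀ e ∈ E, #e = k) →
      (∀ s : Finset (Fin n), #s = k - 1 → (α + ε) * n ≤ (hdeg E s : ℝ)) →
      ∃ i : Fin t, d * n ^ f i ≤ #(embeddings (F i) E) := by
  have hη : 0 < ε / 3 := by positivity
  obtain ⟨m₀, hm₀⟩ := hγ _ hη
  obtain ⟨m, hmm₀, hkm, hm⟩ := exists_sample_size k m₀ hη
  let J : (i : Fin t) → Finset (Fin (f i) → Fin m) := fun i => {ψ | Function.Injective ψ}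
  let K : ℝ := ∑ i, (#(J i) : ℝ)
  have hK : 0 ≤ K := sum_nonneg fun _ _ => by positivity
  refine ⟨1 / (2 * K + 2), by positivity, 4 * m ^ 2 + 1, fun n hn E hE hdegE => ?_⟩
  have hn0 : 0 < n := by omega
  have hnR : (0 : ℝ) < n := by exact_mod_cast hn0
  have hgood := half_le_card_good (β := α + ε / 3) hk hn0 hE hη (by positivity) hdegE
    (by linarith) hm (by omega)
  by_contra! hcon
  have hcover : ({φ | Function.Injective φ ∧ ∀ s : Finset (Fin m), #s = k - 1 →
      (α + ε / 3) * m ≤ (hdeg (pullback k φ E) s : ℝ)} : Finset (Fin m → Fin n)) ⊆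
      univ.biUnion fun i => (J i).biUnion fun ψ => {φ | φ ∘ ψ ∈ embeddings (F i) E} := by
    intro φ hφ
    simp only [mem_filter, mem_univ, true_and] at hφ
    obtain ⟨i, ψ, hψ, hcopy⟩ := hm₀ m hmm₀ (pullback k φ E)
      (fun e he => (mem_filter.1 he).2.1) hφ.2
    simp only [mem_biUnion, mem_univ, true_and]
    refine ⟨i, ψ, by simpa [J] using hψ, ?_⟩
    simp only [embeddings, mem_filter, mem_univ, true_and]
    refine ⟨hφ.1.comp hψ, fun e he => ?_⟩
    rw [← image_image]
    exact (mem_filter.1 (hcopy e he)).2.2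
  have hψ : ∀ i, ∀ ψ ∈ J i, (#{φ : Fin m → Fin n | φ ∘ ψ ∈ embeddings (F i) E} : ℝ) ≤
      1 / (2 * K + 2) * n ^ m := by
    intro i ψ hψ
    have h := card_comp_mem_mul_le (n := n) (mem_filter.1 hψ).2 (embeddings (F i) E)
    have h' : (#{φ : Fin m → Fin n | φ ∘ ψ ∈ embeddings (F i) E} : ℝ) * n ^ f i ≤
        #(embeddings (F i) E) * n ^ m := by exact_mod_cast h
    have hpos : (0 : ℝ) < n ^ f i := by positivity
    refine le_of_mul_le_mul_right (h'.trans ?_) hpos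
    calc (#(embeddings (F i) E) : ℝ) * n ^ m ≤ 1 / (2 * K + 2) * n ^ f i * n ^ m := by
          gcongr; exact (hcon i).le
      _ = 1 / (2 * K + 2) * n ^ m * n ^ f i := by ring
  have hup : (n : ℝ) ^ m / 2 ≤ K * (1 / (2 * K + 2) * n ^ m) := by
    refine hgood.trans ((Nat.cast_le.2 ((card_le_card hcover).trans card_biUnion_le)).trans ?_)
    push_cast
    rw [sum_mul]
    refine sum_le_sum fun i _ => ?_
    refine (Nat.cast_le.2 card_biUnion_le).trans ?_
    push_cast
    exact (sum_le_card_nsmul _ _ _ (hψ i)).trans_eq (nsmul_eq_mul _ _)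
  clear_value K
  have hlt : K * (1 / (2 * K + 2)) < 1 / 2 := by
    rw [mul_one_div, div_lt_div_iff₀ (by positivity) (by norm_num)]
    linarith
  have hnm : (0 : ℝ) < n ^ m := by positivity
  nlinarith

/-- Each vertex set is the image of few embeddings. -/
theorem card_embeddings_le {r n : ℕ} (F : Finset (Finset (Fin r)))
    (E : Finset (Finset (Fin n))) :
    #(embeddings F E) ≤ r ^ r * #(((univ : Finset (Fin n)).powersetCard r).filter
      fun S => HasCopy F (E.filter fun e => e ⊆ S)) := by
  refine (card_le_mul_card_image (f := fun χ : Fin r → Fin n => univ.image χ) _ (r ^ r)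
    fun S hS => ?_).trans (Nat.mul_le_mul_left _ (card_le_card fun S hS => ?_))
  · obtain ⟨χ, hχ, rfl⟩ := mem_image.1 hS
    have hcard : #(univ.image χ) = r := by
      rw [card_image_of_injective _ (mem_filter.1 hχ).2.1, card_fin]
    calc _ ≤ #(Fintype.piFinset fun _ : Fin r => univ.image χ) := card_le_card fun g hg => by
            rw [Fintype.mem_piFinset, ← (mem_filter.1 hg).2]
            exact fun u => mem_image_of_mem _ (mem_univ u)
      _ = r ^ r := by simp [hcard]
  · obtain ⟨χ, hχ, rfl⟩ := mem_image.1 hS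
    have hχ' := (mem_filter.1 hχ).2
    refine mem_filter.2 ⟨mem_powersetCard.2 ⟨subset_univ _, ?_⟩, χ, hχ'.1, fun e he =>
      mem_filter.2 ⟨hχ'.2 e he, image_subset_image (subset_univ e)⟩⟩
    rw [card_image_of_injective _ hχ'.1, card_fin]

/-- A box of embeddings of `F` gives a copy of the blow-up of `F`. -/
theorem hasCopy_blowup_of_box {r n c : ℕ} {F : Finset (Finset (Fin r))}
    {E : Finset (Finset (Fin n))} {b : Fin r → Fin (c + 1) → Fin n}
    (hb : ∀ u, Function.Injective (b u))
    (hbox : ∀ j : Fin r → Fin (c + 1), (fun u => b u (j u)) ∈ embeddings F E) :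
    HasCopy (blowup F c) E := by
  have hbox' := fun j => (mem_filter.1 (hbox j)).2
  refine ⟨fun q => b q.1 q.2.castSucc, ?_, fun S hS => ?_⟩
  · rintro ⟨u, x⟩ ⟨v, y⟩ h
    simp only at h
    by_cases huv : u = v
    · subst huv
      simpa using hb u h
    · refine absurd ((hbox' (Function.update (fun _ => y.castSucc) u x.castSucc)).1 ?_) huv
      simpa [Ne.symm huv] using h
  · obtain ⟨-, hF, hcard⟩ := mem_filter.1 hS
    have hinj : Set.InjOn Prod.fst (S : Set (Fin r × Fin c)) := card_image_iff.1 hcard.symm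
    let j : Fin r → Fin (c + 1) := fun u =>
      if h : ∃ x, (u, x) ∈ S then h.choose.castSucc else Fin.last c
    have hj : ∀ q ∈ S, j q.1 = q.2.castSucc := by
      intro q hq
      have h : ∃ x, (q.1, x) ∈ S := ⟨q.2, hq⟩
      have heq : (q.1, h.choose) = q := hinj h.choose_spec hq rfl
      simp only [j, dif_pos h]
      rw [← congrArg Prod.snd heq]
    have himage := (hbox' j).2 _ hF
    rw [image_image] at himage
    convert himage using 1
    exact image_congr fun q hq => by simp [hj q hq]

/-- supersaturation: Let `t, k, c ∈ ℕ` with `k ≥ 2`, let `𝓕 = {F_1, …, F_t}` be a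
finite family of `k`-uniform hypergraphs with `|V(F_i)| = f_i`, and let `α ∈ [0,1]` be such that
for every `δ > 0` there exists `m₀` such that every `k`-uniform hypergraph on `m ≥ m₀` vertices
with minimum codegree at least `(α+δ)m` contains a copy of some `F_i`. Then for every `ε > 0`
there exists `ζ > 0` such that for all sufficiently large `n`: every `k`-uniform hypergraph `H`
on `n` vertices with `δ(H) ≥ (α+ε)n` contains, for some `i`, at least `ζ·C(n, f_i)` sets `S`
of `f_i` vertices with `F_i ⊆ H[S]`; consequently `H` contains a copy of `F_i(c)`. -/
theorem statement6 (t k c : ℕ) (hk : 2 ≤ k) (f : Fin t → ℕ)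
    (F : (i : Fin t) → Finset (Finset (Fin (f i))))
    (hF : ∀ i, ∀ e ∈ F i, e.card = k)
    (α : ℝ) (hα : α ∈ Set.Icc (0 : ℝ) 1)
    (hγ : ∀ δ : ℝ, 0 < δ → ∃ m₀ : ℕ, ∀ m ≥ m₀, ∀ E : Finset (Finset (Fin m)),
      (∀ e ∈ E, e.card = k) →
      (∀ s : Finset (Fin m), s.card = k - 1 → (α + δ) * m ≤ (hdeg E s : ℝ)) →
      ∃ i, HasCopy (F i) E) :
    ∀ ε : ℝ, 0 < ε → ∃ ζ : ℝ, 0 < ζ ∧ ∃ n₀ : ℕ, ∀ n ≥ n₀,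
      ∀ E : Finset (Finset (Fin n)), (∀ e ∈ E, e.card = k) →
      (∀ s : Finset (Fin n), s.card = k - 1 → (α + ε) * n ≤ (hdeg E s : ℝ)) →
      ∃ i : Fin t,
        ζ * (n.choose (f i) : ℝ) ≤
          (((Finset.univ : Finset (Fin n)).powersetCard (f i)).filter
            (fun S : Finset (Fin n) => HasCopy (F i) (E.filter fun e => e ⊆ S))).card ∧
        HasCopy (blowup (F i) c) E := by
  intro ε hε
  obtain ⟨d, hd, n₁, hn₁⟩ := exists_many_embeddings (by omega) f F hα.1 hγ hε
  choose n₂ hn₂ using fun i => exists_box c (f i) d hd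
  let M : ℝ := 1 + ∑ i, ((f i : ℝ) ^ f i)
  have hM : ∀ i, (f i : ℝ) ^ f i ≤ M := fun i =>
    (single_le_sum (f := fun i => (f i : ℝ) ^ f i) (fun _ _ => by positivity)
      (mem_univ i)).trans (by simp [M])
  have hMpos : 0 < M := by positivity
  refine ⟨d / M, by positivity, n₁ + ∑ i, n₂ i, fun n hn E hE hdegE => ?_⟩
  obtain ⟨i, hi⟩ := hn₁ n (by omega) E hE hdegE
  have hni : n ≥ n₂ i := by
    have := single_le_sum (f := n₂) (fun _ _ => Nat.zero_le _) (mem_univ i)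
    omega
  obtain ⟨b, hb, hbox⟩ := hn₂ i n hni _ hi
  refine ⟨i, ?_, hasCopy_blowup_of_box hb hbox⟩
  have hcount := (Nat.cast_le (α := ℝ)).2 (card_embeddings_le (F i) E)
  push_cast at hcount
  rw [div_mul_eq_mul_div, div_le_iff₀' hMpos]
  calc d * (n.choose (f i) : ℝ) ≤ d * n ^ f i := by
        gcongr
        exact_mod_cast Nat.choose_le_pow n (f i)
    _ ≤ _ := hi.trans hcount
    _ ≤ _ := mul_le_mul_of_nonneg_right (hM i) (Nat.cast_nonneg _)
end
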